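/- arXiv:2101.03930 — 7 statements merged into one kernel-verified Lean document; each statement's English description precedes it below -/
import Mathlib

section
/- Let η : ℝ → ℝ be a cutoff function (twice continuous differentiability suffices). Then there exists a constant C > 0 such that for every real N ≥ 1, |∑_{n=1}^∞ (−1)^{n−1} η(n/N) − 1/2| ≤ C/N. (The sum has only finitely many nonzero terms since η vanishes on [1,∞).) In other words, the smoothed partial sums of Grandi's series 1 − 1 + 1 − ⋯ equal 1/2 + O(1/N). -/
open Filter Topology

theorem abs_sub_le_of_abs_deriv_le {f : ℝ → ℝ} (hf : Differentiable ℝ f) {a b K x y : ℝ}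
    (hK : ∀ z ∈ Set.Icc a b, |deriv f z| ≤ K) (hx : a ≤ x) (hxy : x ≤ y) (hy : y ≤ b) :
    |f y - f x| ≤ K * (y - x) := by
  have h := (convex_Icc a b).norm_image_sub_le_of_norm_deriv_le (𝕜 := ℝ) (f := f)
    (fun z _ => hf z) hK (x := x) (y := y) ⟨hx, hxy.trans hy⟩ ⟨hx.trans hxy, hy⟩
  rwa [Real.norm_eq_abs, Real.norm_eq_abs, abs_of_nonneg (sub_nonneg.2 hxy)] at h

theorem abs_second_difference_le {f : ℝ → ℝ} (hf : Differentiable ℝ f)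
    (hf' : Differentiable ℝ (deriv f)) {a b K x h : ℝ}
    (hK : ∀ z ∈ Set.Icc a b, |deriv (deriv f) z| ≤ K) (hx : a ≤ x) (hh : 0 ≤ h)
    (hb : x + h + h ≤ b) :
    |f x - 2 * f (x + h) + f (x + h + h)| ≤ K * h ^ 2 := by
  have hd : ∀ z, HasDerivAt (fun z => f (z + h) - f z) (deriv f (z + h) - deriv f z) z :=
    fun z => ((hf (z + h)).hasDerivAt.comp_add_const z h).sub (hf z).hasDerivAt
  have key := abs_sub_le_of_abs_deriv_le (f := fun z => f (z + h) - f z)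
    (fun z => (hd z).differentiableAt) (a := x) (b := x + h) (K := K * h) (x := x) (y := x + h)
    (fun z hz => by
      rw [(hd z).deriv]
      have := abs_sub_le_of_abs_deriv_le hf' hK (x := z) (y := z + h) (hx.trans hz.1)
        (by linarith) (by linarith [hz.2])
      simpa using this) le_rfl (by linarith) le_rfl
  calc |f x - 2 * f (x + h) + f (x + h + h)|
      = |f (x + h + h) - f (x + h) - (f (x + h) - f x)| := by congr 1; ring
    _ ≤ K * h * (x + h - x) := key
    _ = K * h ^ 2 := by ring

theorem alternating_sum_second_difference (a : ℕ → ℝ) (M : ℕ) :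
    4 * ∑ n ∈ Finset.range M, (-1 : ℝ) ^ n * a (n + 1) =
      a 0 + a 1 - (-1) ^ M * (a M + a (M + 1)) -
        ∑ n ∈ Finset.range M, (-1 : ℝ) ^ n * (a n - 2 * a (n + 1) + a (n + 2)) := by
  induction M with
  | zero => simp
  | succ M ih =>
    rw [Finset.sum_range_succ, Finset.sum_range_succ, mul_add, ih, pow_succ]
    ring

/-- Smoothed partial sums of Grandi's series `1 - 1 + 1 - ⋯` equal `1/2 + O(1/N)`:
for a cutoff function `η` (smooth, `η 0 = 1`, vanishing on `[1, ∞)`), there is `C > 0`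
with `|∑_{n=1}^∞ (-1)^(n-1) η(n/N) - 1/2| ≤ C / N` for all real `N ≥ 1`. -/
theorem grandi_smoothed_sum (η : ℝ → ℝ) (hη : ContDiff ℝ (⊤ : ℕ∞) η) (hη0 : η 0 = 1)
    (hηvanish : ∀ x : ℝ, 1 ≤ x → η x = 0) :
    ∃ C : ℝ, 0 < C ∧ ∀ N : ℝ, 1 ≤ N →
      |(∑' n : ℕ, (-1 : ℝ) ^ n * η (((n : ℝ) + 1) / N)) - 1 / 2| ≤ C / N := by
  obtain ⟨hd, hη'⟩ := contDiff_infty_iff_deriv.1 hη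
  obtain ⟨hd', hη''⟩ := contDiff_infty_iff_deriv.1 hη'
  obtain ⟨K₁, hK₁⟩ := (isCompact_Icc (a := (0 : ℝ)) (b := 3)).exists_bound_of_continuousOn
    hη'.continuous.continuousOn
  obtain ⟨K₂, hK₂⟩ := (isCompact_Icc (a := (0 : ℝ)) (b := 3)).exists_bound_of_continuousOn
    hη''.continuous.continuousOn
  have hK₁0 : 0 ≤ K₁ := (norm_nonneg _).trans (hK₁ 0 (by norm_num))
  have hK₂0 : 0 ≤ K₂ := (norm_nonneg _).trans (hK₂ 0 (by norm_num))
  refine ⟨K₁ + 2 * K₂ + 1, by positivity, fun N hN => ?_⟩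
  have hN0 : 0 < N := by linarith
  set M := ⌈N⌉₊ with hM
  have hNM : N ≤ M := Nat.le_ceil N
  have hMN : (M : ℝ) < N + 1 := Nat.ceil_lt_add_one hN0.le
  have hvan : ∀ x : ℝ, N ≤ x → η (x / N) = 0 := fun x hx =>
    hηvanish _ ((one_le_div hN0).2 hx)
  have hsum : (∑' n : ℕ, (-1 : ℝ) ^ n * η (((n : ℝ) + 1) / N)) =
      ∑ n ∈ Finset.range M, (-1 : ℝ) ^ n * η (((n : ℝ) + 1) / N) := by
    refine tsum_eq_sum fun n hn => ?_
    have hMn : (M : ℝ) ≤ n := by exact_mod_cast not_lt.1 (mt Finset.mem_range.2 hn)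
    rw [hvan _ (by linarith), mul_zero]
  have hid := alternating_sum_second_difference (fun n => η ((n : ℝ) / N)) M
  push_cast at hid
  rw [hvan _ hNM, hvan ((M : ℝ) + 1) (by linarith), zero_div, hη0] at hid
  have hfirst : |η ((0 + 1) / N) - 1| ≤ K₁ / N := by
    have h1 : 1 / N ≤ 1 := (div_le_one hN0).2 hN
    have := abs_sub_le_of_abs_deriv_le hd hK₁ le_rfl (x := 0) (y := 1 / N) (by positivity)
      (by linarith)
    rw [hη0] at this
    simpa [div_eq_mul_inv] using this
  have hsecond : |∑ n ∈ Finset.range M, (-1 : ℝ) ^ n *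
      (η ((n : ℝ) / N) - 2 * η (((n : ℝ) + 1) / N) + η (((n : ℝ) + 2) / N))| ≤
        2 * K₂ / N := by
    calc _ ≤ ∑ n ∈ Finset.range M, K₂ * (1 / N) ^ 2 := by
          refine (Finset.abs_sum_le_sum_abs _ _).trans (Finset.sum_le_sum fun n hn => ?_)
          have hnM : (n : ℝ) + 1 ≤ M := by exact_mod_cast Finset.mem_range.1 hn
          rw [abs_mul, abs_pow, abs_neg, abs_one, one_pow, one_mul]
          have e1 : ((n : ℝ) + 1) / N = n / N + 1 / N := by ring
          have e2 : ((n : ℝ) + 2) / N = n / N + 1 / N + 1 / N := by ring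
          have hle : ((n : ℝ) + 2) / N ≤ 3 := (div_le_iff₀ hN0).2 (by linarith)
          rw [e2] at hle
          rw [e1, e2]
          exact abs_second_difference_le hd hd' hK₂ (by positivity) (by positivity) hle
      _ = M * (K₂ * (1 / N) ^ 2) := by simp
      _ ≤ (2 * N) * (K₂ * (1 / N) ^ 2) := by gcongr; linarith
      _ = 2 * K₂ / N := by field_simp
  rw [hsum]
  have hC : (K₁ + 2 * K₂ + 1) / N = K₁ / N + 2 * K₂ / N + 1 / N := by ring
  have hpos : 0 < 1 / N := by positivity
  norm_num at hid hfirst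
  rw [hC]
  rw [abs_le] at *
  constructor <;> linarith
end

section
/- Let η : ℝ → ℝ be a cutoff function and let s be a natural number. Then there exists a constant C > 0 such that for every real N ≥ 1, |∑_{n=1}^∞ η(n/N) n^s + B'_{s+1}/(s+1) − C_{η,s} · N^{s+1}| ≤ C/N, where C_{η,s} = ∫_0^∞ x^s η(x) dx is the Mellin-type moment of η. (Tao's smoothed-sum asymptotics: the Ramanujan value −B'_{s+1}/(s+1) is the constant term in the asymptotic expansion of the smoothed partial sums of ∑ n^s.) -/
open Filter Topology

open scoped Nat

/-- The Bernoulli polynomials normalised by `k !` form a sequence of successive antiderivatives. -/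
theorem hasDerivAt_bernoulliFun_div_factorial (k : ℕ) (x : ℝ) :
    HasDerivAt (fun x => bernoulliFun (k + 1) x / (k + 1)!) (bernoulliFun k x / k !) x := by
  convert! (hasDerivAt_bernoulliFun (k + 1) x).div_const ((k + 1)! : ℝ) using 1
  rw [Nat.factorial_succ]
  push_cast
  field_simp

theorem bernoulliFun_one_eq_bernoulli' (k : ℕ) : bernoulliFun k 1 = (bernoulli' k : ℝ) := by
  rw [bernoulliFun, Polynomial.eval_one_map, Polynomial.bernoulli_eval_one, eq_ratCast]

theorem integral_bernoulliFun_mul_by_parts {h : ℝ → ℝ} (hh : ContDiff ℝ 1 h) (k : ℕ) (a : ℝ) :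
    ∫ x in (0 : ℝ)..1, bernoulliFun k x / k ! * h (a + x) =
      (bernoulli' (k + 1) : ℝ) / (k + 1)! * h (a + 1)
        - (bernoulli (k + 1) : ℝ) / (k + 1)! * h a
        - ∫ x in (0 : ℝ)..1, bernoulliFun (k + 1) x / (k + 1)! * deriv h (a + x) := by
  have hd : Continuous (deriv h) := hh.continuous_deriv le_rfl
  have hparts := intervalIntegral.integral_mul_deriv_eq_deriv_mul (a := (0 : ℝ)) (b := 1)
    (u := fun x => bernoulliFun (k + 1) x / (k + 1)!) (u' := fun x => bernoulliFun k x / k !)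
    (v := fun x => h (a + x)) (v' := fun x => deriv h (a + x))
    (fun x _ => hasDerivAt_bernoulliFun_div_factorial k x)
    (fun x _ => ((hh.differentiable one_ne_zero) (a + x)).hasDerivAt.comp_const_add a x)
    (Continuous.intervalIntegrable (by fun_prop) _ _)
    (Continuous.intervalIntegrable (by fun_prop) _ _)
  simp only [bernoulliFun_one_eq_bernoulli', bernoulliFun_eval_zero, add_zero] at hparts
  linarith

/-- The Euler-Maclaurin formula on an interval of length one. -/
theorem euler_maclaurin_unit_interval {f : ℝ → ℝ} (hf : ContDiff ℝ (⊤ : ℕ∞) f) (k : ℕ) (a : ℝ) :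
    f (a + 1) = (∫ x in a..(a + 1), f x)
      + ∑ j ∈ Finset.range (k + 1), (bernoulli' (j + 1) : ℝ) / (j + 1)!
          * (iteratedDeriv j f (a + 1) - iteratedDeriv j f a)
      + (-1) ^ k * ∫ x in (0 : ℝ)..1,
          bernoulliFun (k + 1) x / (k + 1)! * iteratedDeriv (k + 1) f (a + x) := by
  have hsmooth (j : ℕ) : ContDiff ℝ 1 (iteratedDeriv j f) := by
    rw [iteratedDeriv_eq_iterate]
    exact ContDiff.iterate_deriv' 1 j <| hf.of_le (by exact_mod_cast le_top)
  induction k with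
  | zero =>
    have hparts := integral_bernoulliFun_mul_by_parts (hsmooth 0) 0 a
    simp [iteratedDeriv_one, intervalIntegral.integral_comp_add_left] at hparts ⊢
    linarith
  | succ k ih =>
    rw [Finset.sum_range_succ]
    have hparts := integral_bernoulliFun_mul_by_parts (hsmooth (k + 1)) (k + 1) a
    rw [← iteratedDeriv_succ, bernoulli_eq_bernoulli'_of_ne_one (by omega)] at hparts
    rw [hparts] at ih
    have hsign : (bernoulli' (k + 1 + 1) : ℝ) = (-1) ^ k * (bernoulli' (k + 1 + 1) : ℝ) := by
      rcases Nat.even_or_odd k with hk | hk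
      · simp [hk.neg_one_pow]
      · rw [bernoulli'_eq_zero_of_odd (by grind) (by have := hk.pos; omega)]
        simp
    rw [pow_succ]
    linear_combination ih - (iteratedDeriv (k + 1) f (a + 1) - iteratedDeriv (k + 1) f a)
      / (k + 1 + 1)! * hsign

/-- The Euler-Maclaurin formula on `[0, M]`. -/
theorem euler_maclaurin {f : ℝ → ℝ} (hf : ContDiff ℝ (⊤ : ℕ∞) f) (k M : ℕ) :
    ∑ n ∈ Finset.range M, f (n + 1) = (∫ x in (0 : ℝ)..M, f x)
      + ∑ j ∈ Finset.range (k + 1), (bernoulli' (j + 1) : ℝ) / (j + 1)!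
          * (iteratedDeriv j f M - iteratedDeriv j f 0)
      + (-1) ^ k * ∑ n ∈ Finset.range M, ∫ x in (0 : ℝ)..1,
          bernoulliFun (k + 1) x / (k + 1)! * iteratedDeriv (k + 1) f (n + x) := by
  induction M with
  | zero => simp
  | succ M ih =>
    rw [Finset.sum_range_succ _ M, Finset.sum_range_succ _ M, ih,
      euler_maclaurin_unit_interval hf k M, Nat.cast_succ,
      ← intervalIntegral.integral_add_adjacent_intervals (a := 0) (b := M) (c := M + 1)
        (hf.continuous.intervalIntegrable _ _) (hf.continuous.intervalIntegrable _ _)]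
    simp only [mul_sub, Finset.sum_sub_distrib]
    ring

theorem iteratedDeriv_comp_div {g : ℝ → ℝ} (hg : ContDiff ℝ (⊤ : ℕ∞) g) (j : ℕ) (N x : ℝ) :
    iteratedDeriv j (fun x => g (x / N)) x = iteratedDeriv j g (x / N) / N ^ j := by
  have h := congrFun (iteratedDeriv_comp_const_mul (n := j)
    (hg.of_le (by exact_mod_cast le_top)) N⁻¹) x
  simp only [inv_mul_eq_div, inv_pow] at h
  exact h

/-- The Euler-Maclaurin expansion of `∑ g (n / N)` for a smooth function `g` vanishing on
`[1, ∞)`. -/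
theorem exists_abs_tsum_comp_div_sub_le {g : ℝ → ℝ} (hg : ContDiff ℝ (⊤ : ℕ∞) g)
    (hvanish : ∀ x : ℝ, 1 ≤ x → g x = 0) (k : ℕ) :
    ∃ C : ℝ, ∀ N : ℝ, 1 ≤ N →
      |(∑' n : ℕ, g (((n : ℝ) + 1) / N)) - N * (∫ x in Set.Ioi (0 : ℝ), g x)
        + ∑ j ∈ Finset.range (k + 1), (bernoulli' (j + 1) : ℝ) / (j + 1)!
          * (iteratedDeriv j g 0 / N ^ j)| ≤ C / N ^ k := by
  have hcont : Continuous (iteratedDeriv (k + 1) g) :=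
    hg.continuous_iteratedDeriv (k + 1) (by exact_mod_cast le_top)
  obtain ⟨G, hG⟩ := (isCompact_Icc (a := (0 : ℝ)) (b := 2)).exists_bound_of_continuousOn
    hcont.continuousOn
  obtain ⟨B, hB⟩ := (isCompact_Icc (a := (0 : ℝ)) (b := 1)).exists_bound_of_continuousOn
    (f := fun x => bernoulliFun (k + 1) x / (k + 1)!) (by fun_prop)
  have hG0 : 0 ≤ G := (norm_nonneg _).trans (hG 0 (by simp))
  have hB0 : 0 ≤ B := (norm_nonneg _).trans (hB 0 (by simp))
  refine ⟨2 * (B * G), fun N hN => ?_⟩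
  have hN0 : 0 < N := by linarith
  set M := ⌊N⌋₊ + 1 with hM
  have hNM : N < M := by simpa [hM] using Nat.lt_floor_add_one N
  have hM2 : (M : ℝ) ≤ 2 * N := by
    have := Nat.floor_le hN0.le
    push_cast [hM]
    linarith
  have hMN : 1 < M / N := (one_lt_div hN0).2 hNM
  have hsum : ∑' n : ℕ, g (((n : ℝ) + 1) / N) =
      ∑ n ∈ Finset.range M, g (((n : ℝ) + 1) / N) := by
    refine tsum_eq_sum fun n hn => hvanish _ ((one_le_div hN0).2 ?_)
    have : (M : ℝ) ≤ n := by exact_mod_cast not_lt.1 (mt Finset.mem_range.2 hn)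
    linarith
  have hintegral : ∫ x in (0 : ℝ)..M, g (x / N) = N * ∫ x in Set.Ioi (0 : ℝ), g x := by
    rw [intervalIntegral.integral_comp_div _ hN0.ne', zero_div, smul_eq_mul,
      intervalIntegral.integral_of_le (by positivity)]
    congr 1
    refine (MeasureTheory.setIntegral_eq_of_subset_of_forall_sdiff_eq_zero measurableSet_Ioi
      Set.Ioc_subset_Ioi_self fun x hx => hvanish x ?_).symm
    simp only [Set.mem_sdiff, Set.mem_Ioi, Set.mem_Ioc, not_and, not_le] at hx
    linarith [hx.2 hx.1]
  have hzero (j : ℕ) : iteratedDeriv j g (M / N) = 0 := by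
    have : g =ᶠ[𝓝 (M / N)] fun _ => (0 : ℝ) := by
      filter_upwards [lt_mem_nhds hMN] with x hx using hvanish x hx.le
    rw [this.iteratedDeriv_eq]
    simp
  have hrem (n : ℕ) (hn : n ∈ Finset.range M) : ‖∫ x in (0 : ℝ)..1,
      bernoulliFun (k + 1) x / (k + 1)! * (iteratedDeriv (k + 1) g ((n + x) / N) / N ^ (k + 1))‖
        ≤ B * (G / N ^ (k + 1)) := by
    refine (intervalIntegral.norm_integral_le_of_norm_le_const
      (C := B * (G / N ^ (k + 1))) fun x hx => ?_).trans_eq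
      (by simp)
    rw [Set.uIoc_of_le zero_le_one] at hx
    have hn' : (n : ℝ) + 1 ≤ M := by exact_mod_cast Finset.mem_range.1 hn
    rw [norm_mul, norm_div (iteratedDeriv _ _ _), norm_pow, Real.norm_of_nonneg hN0.le]
    gcongr
    · exact hB x ⟨hx.1.le, hx.2⟩
    · exact hG _ ⟨div_nonneg (by linarith [hx.1, n.cast_nonneg (α := ℝ)]) hN0.le,
        by rw [div_le_iff₀ hN0]; linarith [hx.2]⟩
  have hEM := euler_maclaurin (f := fun x => g (x / N)) (hg.comp (contDiff_id.div_const N)) k M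
  simp only [iteratedDeriv_comp_div hg, hzero, hintegral, zero_div, zero_sub, mul_neg,
    Finset.sum_neg_distrib] at hEM
  rw [hsum, hEM]
  calc _ = ‖∑ n ∈ Finset.range M, ∫ x in (0 : ℝ)..1, bernoulliFun (k + 1) x / (k + 1)!
          * (iteratedDeriv (k + 1) g ((n + x) / N) / N ^ (k + 1))‖ := by
        rw [add_assoc, add_sub_cancel_left, neg_add_cancel_comm, abs_mul, abs_neg_one_pow, one_mul, Real.norm_eq_abs]
    _ ≤ ∑ n ∈ Finset.range M, B * (G / N ^ (k + 1)) := norm_sum_le_of_le _ hrem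
    _ = M * (B * (G / N ^ (k + 1))) := by simp
    _ ≤ 2 * N * (B * (G / N ^ (k + 1))) := by gcongr
    _ = 2 * (B * G) / N ^ k := by
        rw [pow_succ]
        field_simp

theorem iteratedDeriv_pow_mul_zero {η : ℝ → ℝ} (hη : ContDiff ℝ (⊤ : ℕ∞) η) {s j : ℕ}
    (hj : j ≤ s) :
    iteratedDeriv j (fun x => x ^ s * η x) 0 = if j = s then s ! * η 0 else 0 := by
  have hmul : (fun x => x ^ s * η x) = (fun x => x ^ s) * η := rfl
  rw [hmul, iteratedDeriv_mul (by fun_prop) (hη.contDiffAt.of_le (by exact_mod_cast le_top))]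
  simp only [iteratedDeriv_fun_pow_zero]
  split_ifs with h
  · subst h
    rw [Finset.sum_eq_single j] <;> simp +contextual
  · refine Finset.sum_eq_zero fun i hi => ?_
    have := Finset.mem_range.1 hi
    rw [if_neg (by omega)]
    simp

/-- Tao's smoothed-sum asymptotics: for a cutoff function `η` and `s : ℕ`, there is
`C > 0` such that for all real `N ≥ 1`,
`|∑_{n=1}^∞ η(n/N) n^s + B'_{s+1}/(s+1) - C_{η,s} N^{s+1}| ≤ C / N`,
where `C_{η,s} = ∫_0^∞ x^s η(x) dx` and `B'` are the Bernoulli numbers with `B'_1 = 1/2`. -/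
theorem tao_smoothed_sum_asymptotics (η : ℝ → ℝ) (hη : ContDiff ℝ (⊤ : ℕ∞) η) (hη0 : η 0 = 1)
    (hηvanish : ∀ x : ℝ, 1 ≤ x → η x = 0) (s : ℕ) :
    ∃ C : ℝ, 0 < C ∧ ∀ N : ℝ, 1 ≤ N →
      |(∑' n : ℕ, η (((n : ℝ) + 1) / N) * ((n : ℝ) + 1) ^ s)
        + (bernoulli' (s + 1) : ℝ) / ((s : ℝ) + 1)
        - (∫ x in Set.Ioi (0 : ℝ), x ^ s * η x) * N ^ (s + 1)| ≤ C / N := by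
  have hg : ContDiff ℝ (⊤ : ℕ∞) (fun x => x ^ s * η x) := (contDiff_id.pow s).mul hη
  obtain ⟨C, hC⟩ := exists_abs_tsum_comp_div_sub_le hg
    (fun x hx => by rw [hηvanish x hx, mul_zero]) (s + 1)
  set D := (bernoulli' (s + 1 + 1) : ℝ) / (s + 1 + 1)!
    * iteratedDeriv (s + 1) (fun x => x ^ s * η x) 0
  refine ⟨|C| + |D| + 1, by positivity, fun N hN => ?_⟩
  have hN0 : 0 < N := by linarith
  have hbound := hC N hN
  have hlow : ∑ j ∈ Finset.range s, (bernoulli' (j + 1) : ℝ) / (j + 1)!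
      * (iteratedDeriv j (fun x => x ^ s * η x) 0 / N ^ j) = 0 := by
    refine Finset.sum_eq_zero fun j hj => ?_
    have := Finset.mem_range.1 hj
    rw [iteratedDeriv_pow_mul_zero hη this.le, if_neg this.ne]
    simp
  have hsum : ∑' n : ℕ, η (((n : ℝ) + 1) / N) * ((n : ℝ) + 1) ^ s =
      N ^ s * ∑' n : ℕ, (((n : ℝ) + 1) / N) ^ s * η (((n : ℝ) + 1) / N) := by
    rw [← tsum_mul_left]
    refine tsum_congr fun n => ?_
    rw [div_pow]
    field_simp
  rw [Finset.sum_range_succ, Finset.sum_range_succ, hlow, iteratedDeriv_pow_mul_zero hη le_rfl,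
    if_pos rfl, hη0] at hbound
  set S := ∑' n : ℕ, (((n : ℝ) + 1) / N) ^ s * η (((n : ℝ) + 1) / N)
  set I := ∫ x in Set.Ioi (0 : ℝ), x ^ s * η x
  rw [hsum]
  set R := S - N * I + (0 + (bernoulli' (s + 1) : ℝ) / (s + 1)! * (s ! * 1 / N ^ s)
    + (bernoulli' (s + 1 + 1) : ℝ) / (s + 1 + 1)!
      * (iteratedDeriv (s + 1) (fun x => x ^ s * η x) 0 / N ^ (s + 1))) with hR
  have hsplit : N ^ s * S + (bernoulli' (s + 1) : ℝ) / ((s : ℝ) + 1) - I * N ^ (s + 1)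
      = N ^ s * R - D / N := by
    simp only [hR, D, Nat.factorial_succ s]
    push_cast
    have : (s ! : ℝ) ≠ 0 := by positivity
    field_simp
    ring
  rw [hsplit]
  calc |N ^ s * R - D / N| ≤ |N ^ s * R| + |D / N| := abs_sub _ _
    _ = N ^ s * |R| + |D| / N := by
        rw [abs_mul, abs_div, abs_of_pos hN0, abs_of_pos (pow_pos hN0 s)]
    _ ≤ N ^ s * (|C| / N ^ (s + 1)) + |D| / N := by
        gcongr
        exact hbound.trans (by gcongr; exact le_abs_self C)
    _ = (|C| + |D|) / N := by
        rw [pow_succ]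
        field_simp
    _ ≤ (|C| + |D| + 1) / N := div_le_div_of_nonneg_right (by linarith) hN0.le
end

section
/- Let η : ℝ → ℝ be a cutoff function and let s be a natural number. Then lim_{N→∞} [ ∑_{n=1}^∞ η(n/N) n^s − C_{η,s} · N^{s+1} ] = −B'_{s+1}/(s+1), where C_{η,s} = ∫_0^∞ x^s η(x) dx and the limit is taken over real N → ∞. -/
open Filter Topology

theorem bernoulliFun_eval_one_eq_bernoulli' (k : ℕ) : bernoulliFun k 1 = bernoulli' k := by
  rw [bernoulliFun, Polynomial.eval_one_map, Polynomial.bernoulli_eval_one, eq_ratCast]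

theorem hasDerivAt_bernoulliFun_one_sub_div_factorial (k : ℕ) (x : ℝ) :
    HasDerivAt (fun x => bernoulliFun (k + 1) (1 - x) / (k + 1).factorial)
      (-(bernoulliFun k (1 - x) / k.factorial)) x := by
  have h := ((hasDerivAt_bernoulliFun (k + 1) (1 - x)).comp x
    ((hasDerivAt_id x).const_sub 1)).div_const ((k + 1).factorial : ℝ)
  convert! h using 1
  have : (k.factorial : ℝ) ≠ 0 := by positivity
  have : (k : ℝ) + 1 ≠ 0 := by positivity
  simp only [Nat.factorial_succ, Nat.add_sub_cancel]
  push_cast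
  field_simp

/-- Integration by parts against a Bernoulli polynomial on a unit interval. -/
theorem integral_bernoulliFun_one_sub_mul_deriv {h : ℝ → ℝ} (hh : ContDiff ℝ 1 h) (k : ℕ) (a : ℝ) :
    ∫ x in (0 : ℝ)..1, bernoulliFun (k + 1) (1 - x) / (k + 1).factorial * deriv h (a + x) =
      (bernoulli (k + 1) * h (a + 1) - bernoulli' (k + 1) * h a) / (k + 1).factorial
        + ∫ x in (0 : ℝ)..1, bernoulliFun k (1 - x) / k.factorial * h (a + x) := by
  have hd : Continuous (deriv h) := hh.continuous_deriv le_rfl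
  have hc := hh.continuous
  have hB := fun k => continuous_bernoulliFun k
  rw [intervalIntegral.integral_mul_deriv_eq_deriv_mul (v := fun x => h (a + x))
    (fun x _ => hasDerivAt_bernoulliFun_one_sub_div_factorial k x)
    (fun x _ => ((hh.differentiable one_ne_zero (a + x)).hasDerivAt).comp_const_add a x)
    (Continuous.intervalIntegrable (by fun_prop) _ _)
    (Continuous.intervalIntegrable (by fun_prop) _ _)]
  simp only [neg_mul, intervalIntegral.integral_neg, sub_self, sub_zero, add_zero,
    bernoulliFun_eval_one_eq_bernoulli', bernoulliFun_eval_zero]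
  ring

theorem sum_bernoulli_mul_sub_bernoulli'_mul {h : ℕ → ℝ} {M : ℕ} (hM : h M = 0) (k : ℕ) :
    ∑ n ∈ Finset.range M, ((bernoulli (k + 1) : ℝ) * h (n + 1) - bernoulli' (k + 1) * h n) =
      -(bernoulli' (k + 1) * h 0) - if k = 0 then ∑ n ∈ Finset.range M, h (n + 1) else 0 := by
  have htel : ∑ n ∈ Finset.range M, (h (n + 1) - h n) = -h 0 := by
    rw [Finset.sum_range_sub, hM, zero_sub]
  split_ifs with hk
  · subst hk
    rw [← mul_neg, ← htel, Finset.mul_sum, ← Finset.sum_sub_distrib]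
    refine Finset.sum_congr rfl fun n _ => ?_
    norm_num [bernoulli_one, bernoulli'_one]
    ring
  · rw [bernoulli_eq_bernoulli'_of_ne_one (by lia), sub_zero, ← mul_neg, ← htel, Finset.mul_sum]
    exact Finset.sum_congr rfl fun n _ => by ring

/-- The Euler–Maclaurin formula for a function vanishing to infinite order at the right endpoint. -/
theorem sum_eq_integral_sub_sum_bernoulli' {f : ℝ → ℝ} (hf : ContDiff ℝ (⊤ : ℕ∞) f) {M : ℕ}
    (hM : ∀ k, iteratedDeriv k f M = 0) (m : ℕ) :
    ∑ n ∈ Finset.range M, f (n + 1) =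
      (∫ x in (0 : ℝ)..M, f x)
        - ∑ k ∈ Finset.range (m + 1),
            (bernoulli' (k + 1) : ℝ) * iteratedDeriv k f 0 / (k + 1).factorial
        - ∑ n ∈ Finset.range M, ∫ x in (0 : ℝ)..1,
            bernoulliFun (m + 1) (1 - x) / (m + 1).factorial
              * iteratedDeriv (m + 1) f (n + x) := by
  have hstep (k : ℕ) : ∑ n ∈ Finset.range M, ∫ x in (0 : ℝ)..1,
        bernoulliFun (k + 1) (1 - x) / (k + 1).factorial * iteratedDeriv (k + 1) f (n + x) =
      (-(bernoulli' (k + 1) * iteratedDeriv k f 0)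
        - if k = 0 then ∑ n ∈ Finset.range M, iteratedDeriv k f (n + 1) else 0) / (k + 1).factorial
      + ∑ n ∈ Finset.range M, ∫ x in (0 : ℝ)..1,
        bernoulliFun k (1 - x) / k.factorial * iteratedDeriv k f (n + x) := by
    have hk : ContDiff ℝ 1 (iteratedDeriv k f) :=
      contDiff_nat_succ_iff_contDiff_one_iteratedDeriv.1
        (contDiff_infty.1 hf _) |>.2
    have h := sum_bernoulli_mul_sub_bernoulli'_mul
      (h := fun n : ℕ => iteratedDeriv k f n) (M := M) (hM k) k
    push_cast at h
    rw [← h, Finset.sum_div, ← Finset.sum_add_distrib]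
    refine Finset.sum_congr rfl fun n _ => ?_
    rw [iteratedDeriv_succ]
    exact integral_bernoulliFun_one_sub_mul_deriv hk k n
  induction m with
  | zero =>
    have hint : ∑ n ∈ Finset.range M, ∫ x in (0 : ℝ)..1, f (n + x) = ∫ x in (0 : ℝ)..M, f x := by
      have h := intervalIntegral.sum_integral_adjacent_intervals (f := f) (μ := MeasureTheory.volume)
        (a := fun n : ℕ => (n : ℝ)) (n := M)
        (fun k _ => hf.continuous.intervalIntegrable _ _)
      rw [Nat.cast_zero] at h
      rw [← h]
      exact Finset.sum_congr rfl fun n _ => by simp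
    rw [hstep 0]
    simp only [Nat.factorial_zero, iteratedDeriv_zero, bernoulliFun_zero, Nat.cast_one, div_one,
      one_mul, hint]
    simp
    ring
  | succ m ih =>
    rw [ih, hstep (m + 1), Finset.sum_range_succ _ (m + 1)]
    simp only [Nat.add_eq_zero_iff, one_ne_zero, and_false, if_false]
    ring

theorem iteratedDeriv_pow_mul_zero_of_le {η : ℝ → ℝ} (hη : ContDiff ℝ (⊤ : ℕ∞) η) {k s : ℕ}
    (hk : k ≤ s) :
    iteratedDeriv k (fun x => x ^ s * η x) 0 = if k = s then s.factorial * η 0 else 0 := by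
  have h := iteratedDeriv_mul (n := k) (x := (0 : ℝ)) (f := fun x : ℝ => x ^ s) (g := η)
    (by fun_prop) ((contDiff_infty.1 hη k).contDiffAt)
  simp only [iteratedDeriv_fun_pow_zero] at h
  change iteratedDeriv k ((fun x : ℝ => x ^ s) * η) 0 = _
  rw [h]
  split_ifs with hks
  · subst hks
    rw [Finset.sum_eq_single k]
    · simp
    · intro i _ hi
      simp [hi]
    · simp
  · refine Finset.sum_eq_zero fun i hi => ?_
    rw [Finset.mem_range] at hi
    rw [if_neg (by lia)]
    simp

theorem iteratedDeriv_eq_zero_of_forall_le {g : ℝ → ℝ} {a : ℝ} (hg : ∀ x, a ≤ x → g x = 0)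
    {x : ℝ} (hx : a < x) (k : ℕ) : iteratedDeriv k g x = 0 := by
  have h : g =ᶠ[𝓝 x] fun _ => 0 := by
    filter_upwards [lt_mem_nhds hx] with y hy using hg y hy.le
  rw [h.iteratedDeriv_eq k, iteratedDeriv_fun_const_zero]

theorem setIntegral_Ioi_eq_intervalIntegral {g : ℝ → ℝ} {a b : ℝ} (hab : a ≤ b)
    (hg : ∀ x, b ≤ x → g x = 0) : ∫ x in Set.Ioi a, g x = ∫ x in a..b, g x := by
  rw [intervalIntegral.integral_of_le hab]
  refine MeasureTheory.setIntegral_eq_of_subset_of_forall_sdiff_eq_zero measurableSet_Ioi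
    Set.Ioc_subset_Ioi_self fun x hx => hg x ?_
  by_contra! h
  exact hx.2 ⟨hx.1, h.le⟩

/-- The smoothed sum minus its main term, with an explicit remainder. -/
theorem smoothed_sum_eq {η : ℝ → ℝ} (hη : ContDiff ℝ (⊤ : ℕ∞) η) (hη0 : η 0 = 1)
    (hηvanish : ∀ x : ℝ, 1 ≤ x → η x = 0) (s : ℕ) {N : ℝ} (hN : 0 < N) {M : ℕ} (hM : N < M) :
    (∑' n : ℕ, η (((n : ℝ) + 1) / N) * ((n : ℝ) + 1) ^ s)
        - (∫ x in Set.Ioi (0 : ℝ), x ^ s * η x) * N ^ (s + 1) =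
      -((bernoulli' (s + 1) : ℝ) / ((s : ℝ) + 1))
        - bernoulli' (s + 2) * iteratedDeriv (s + 1) (fun x => x ^ s * η x) 0
            / (s + 2).factorial * N⁻¹
        - (∑ n ∈ Finset.range M, ∫ x in (0 : ℝ)..1,
            bernoulliFun (s + 2) (1 - x) / (s + 2).factorial
              * iteratedDeriv (s + 2) (fun x => x ^ s * η x) (N⁻¹ * (n + x))) * (N⁻¹) ^ 2 := by
  set g : ℝ → ℝ := fun x => x ^ s * η x with hg_def
  have hg : ContDiff ℝ (⊤ : ℕ∞) g := by fun_prop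
  have hgv : ∀ x, 1 ≤ x → g x = 0 := fun x hx => by simp [hg_def, hηvanish x hx]
  set f : ℝ → ℝ := fun x => N ^ s * g (N⁻¹ * x) with hf_def
  have hf : ContDiff ℝ (⊤ : ℕ∞) f := by fun_prop
  have hfd (k : ℕ) (x : ℝ) :
      iteratedDeriv k f x = N ^ s * (N⁻¹) ^ k * iteratedDeriv k g (N⁻¹ * x) := by
    rw [hf_def, iteratedDeriv_const_mul_field,
      iteratedDeriv_comp_const_mul (contDiff_infty.1 hg k), mul_assoc]
  have hN1 {x : ℝ} : 1 ≤ N⁻¹ * x ↔ N ≤ x := by rw [le_inv_mul_iff₀ hN, mul_one]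
  have hN1' : 1 < N⁻¹ * (M : ℝ) := by rwa [lt_inv_mul_iff₀ hN, mul_one]
  have hfM (k : ℕ) : iteratedDeriv k f M = 0 := by
    rw [hfd, iteratedDeriv_eq_zero_of_forall_le hgv hN1', mul_zero]
  have hterm (n : ℕ) : η (((n : ℝ) + 1) / N) * ((n : ℝ) + 1) ^ s = f (n + 1) := by
    simp only [hf_def, hg_def, ← div_eq_inv_mul]
    rw [← mul_assoc, ← mul_pow, mul_div_cancel₀ _ hN.ne', mul_comm]
  have htsum : ∑' n : ℕ, η (((n : ℝ) + 1) / N) * ((n : ℝ) + 1) ^ s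
      = ∑ n ∈ Finset.range M, f (n + 1) := by
    simp only [hterm]
    refine tsum_eq_sum fun n hn => ?_
    rw [Finset.mem_range, not_lt] at hn
    have hn' : (M : ℝ) ≤ n := by exact_mod_cast hn
    simp only [hf_def]
    rw [hgv _ (hN1.2 (by linarith)), mul_zero]
  have hint : (∫ x in Set.Ioi (0 : ℝ), g x) * N ^ (s + 1) = ∫ x in (0 : ℝ)..M, f x := by
    rw [setIntegral_Ioi_eq_intervalIntegral (b := N⁻¹ * M) (by positivity)
      (fun x hx => hgv x (hN1'.le.trans hx)), hf_def, intervalIntegral.integral_const_mul,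
      intervalIntegral.integral_comp_mul_left _ (inv_ne_zero hN.ne'), mul_zero, inv_inv,
      smul_eq_mul]
    ring
  have hsum : ∑ k ∈ Finset.range (s + 1 + 1),
      (bernoulli' (k + 1) : ℝ) * iteratedDeriv k f 0 / (k + 1).factorial =
      (bernoulli' (s + 1) : ℝ) / ((s : ℝ) + 1)
        + bernoulli' (s + 2) * iteratedDeriv (s + 1) g 0 / (s + 2).factorial * N⁻¹ := by
    rw [Finset.sum_range_succ, Finset.sum_range_succ, Finset.sum_eq_zero, zero_add]
    · have hs : iteratedDeriv s g 0 = s.factorial := by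
        rw [iteratedDeriv_pow_mul_zero_of_le hη le_rfl, if_pos rfl, hη0, mul_one]
      have hNs : N ^ s * N⁻¹ ^ s = 1 := by rw [← mul_pow, mul_inv_cancel₀ hN.ne', one_pow]
      rw [hfd, hfd, mul_zero, hs, pow_succ, hNs, one_mul, ← mul_assoc (N ^ s), hNs, one_mul,
        Nat.factorial_succ s]
      have : (s.factorial : ℝ) ≠ 0 := by positivity
      have : (s : ℝ) + 1 ≠ 0 := by positivity
      push_cast
      congr 1
      · field_simp
      · ring
    · intro k hk
      rw [Finset.mem_range] at hk
      rw [hfd, mul_zero, iteratedDeriv_pow_mul_zero_of_le hη hk.le, if_neg hk.ne]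
      simp
  have hrem : ∑ n ∈ Finset.range M, ∫ x in (0 : ℝ)..1,
        bernoulliFun (s + 2) (1 - x) / (s + 2).factorial * iteratedDeriv (s + 2) f (n + x) =
      (∑ n ∈ Finset.range M, ∫ x in (0 : ℝ)..1,
        bernoulliFun (s + 2) (1 - x) / (s + 2).factorial
          * iteratedDeriv (s + 2) g (N⁻¹ * (n + x))) * (N⁻¹) ^ 2 := by
    have hNs : N ^ s * N⁻¹ ^ (s + 2) = (N⁻¹) ^ 2 := by
      rw [pow_add, ← mul_assoc, ← mul_pow, mul_inv_cancel₀ hN.ne', one_pow, one_mul]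
    simp only [hfd, hNs]
    rw [Finset.sum_mul]
    refine Finset.sum_congr rfl fun n _ => ?_
    rw [← intervalIntegral.integral_mul_const]
    congr 1
    ext x
    ring
  rw [htsum, hint, sum_eq_integral_sub_sum_bernoulli' hf hfM (s + 1), hsum, hrem]
  ring

theorem exists_norm_integral_bernoulliFun_mul_le {φ : ℝ → ℝ} (hφ : Continuous φ) (k : ℕ) (R : ℝ) :
    ∃ C : ℝ, 0 ≤ C ∧ ∀ c a : ℝ, 0 ≤ c → 0 ≤ a → c * (a + 1) ≤ R →
      |∫ x in (0 : ℝ)..1, bernoulliFun k (1 - x) / k.factorial * φ (c * (a + x))| ≤ C := by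
  have hB := continuous_bernoulliFun k
  obtain ⟨A, hA⟩ := (isCompact_Icc (a := (0 : ℝ)) (b := 1)).exists_bound_of_continuousOn
    (f := fun x => bernoulliFun k (1 - x) / k.factorial) (by fun_prop)
  obtain ⟨D, hD⟩ := (isCompact_Icc (a := (0 : ℝ)) (b := R)).exists_bound_of_continuousOn
    hφ.continuousOn
  have hA0 : 0 ≤ A := (norm_nonneg _).trans (hA 0 (by simp))
  refine ⟨A * |D|, by positivity, fun c a hc ha hR => ?_⟩
  have h := intervalIntegral.norm_integral_le_of_norm_le_const (a := (0 : ℝ)) (b := 1)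
    (C := A * |D|) (f := fun x => bernoulliFun k (1 - x) / k.factorial * φ (c * (a + x))) ?_
  · simpa using h
  · intro x hx
    rw [Set.uIoc_of_le zero_le_one] at hx
    rw [norm_mul]
    have hx1 : c * (a + x) ≤ R := le_trans (by gcongr; exact hx.2) hR
    have hx0 : 0 ≤ c * (a + x) := mul_nonneg hc (by linarith [hx.1])
    exact mul_le_mul (hA x ⟨hx.1.le, hx.2⟩) ((hD _ ⟨hx0, hx1⟩).trans (le_abs_self D))
      (norm_nonneg _) hA0

/-- For a cutoff function `η` and `s : ℕ`,
`lim_{N→∞} [∑_{n=1}^∞ η(n/N) n^s - C_{η,s} N^{s+1}] = -B'_{s+1}/(s+1)`,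
where `C_{η,s} = ∫_0^∞ x^s η(x) dx`, the limit being over real `N → ∞`. -/
theorem tao_smoothed_sum_limit (η : ℝ → ℝ) (hη : ContDiff ℝ (⊤ : ℕ∞) η) (hη0 : η 0 = 1)
    (hηvanish : ∀ x : ℝ, 1 ≤ x → η x = 0) (s : ℕ) :
    Tendsto (fun N : ℝ =>
        (∑' n : ℕ, η (((n : ℝ) + 1) / N) * ((n : ℝ) + 1) ^ s)
          - (∫ x in Set.Ioi (0 : ℝ), x ^ s * η x) * N ^ (s + 1))
      atTop (𝓝 (-((bernoulli' (s + 1) : ℝ) / ((s : ℝ) + 1)))) := by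
  have hg : ContDiff ℝ (⊤ : ℕ∞) (fun x => x ^ s * η x) := by fun_prop
  obtain ⟨C, hC0, hC⟩ := exists_norm_integral_bernoulliFun_mul_le
    ((contDiff_infty.1 hg (s + 2)).continuous_iteratedDeriv' (s + 2)) (s + 2) 2
  set R : ℝ → ℝ := fun N => (∑ n ∈ Finset.range (⌊N⌋₊ + 1), ∫ x in (0 : ℝ)..1,
    bernoulliFun (s + 2) (1 - x) / (s + 2).factorial
      * iteratedDeriv (s + 2) (fun x => x ^ s * η x) (N⁻¹ * (n + x))) * (N⁻¹) ^ 2 with hR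
  have hM {N : ℝ} (hN : 1 ≤ N) : ((⌊N⌋₊ + 1 : ℕ) : ℝ) ≤ 2 * N := by
    push_cast
    linarith [Nat.floor_le (zero_le_one.trans hN)]
  have hR0 : Tendsto R atTop (𝓝 0) := by
    have hlim : Tendsto (fun N : ℝ => 2 * C * N⁻¹) atTop (𝓝 0) := by
      simpa using tendsto_inv_atTop_zero.const_mul (2 * C)
    refine squeeze_zero_norm' ?_ hlim
    filter_upwards [eventually_ge_atTop 1] with N hN
    have hN0 : 0 < N := by linarith
    have hsum := Finset.abs_sum_le_sum_abs (fun n : ℕ => ∫ x in (0 : ℝ)..1,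
      bernoulliFun (s + 2) (1 - x) / (s + 2).factorial
        * iteratedDeriv (s + 2) (fun x => x ^ s * η x) (N⁻¹ * (n + x)))
      (Finset.range (⌊N⌋₊ + 1))
    have hbound := Finset.sum_le_card_nsmul (Finset.range (⌊N⌋₊ + 1)) _ C fun n hn =>
      hC N⁻¹ n (by positivity) (by positivity) (by
        rw [inv_mul_le_iff₀ hN0, mul_comm N]
        refine le_trans ?_ (hM hN)
        exact_mod_cast Finset.mem_range.1 hn)
    rw [Finset.card_range, nsmul_eq_mul] at hbound
    rw [hR, Real.norm_eq_abs, abs_mul, abs_of_nonneg (a := N⁻¹ ^ 2) (by positivity)]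
    calc _ ≤ (2 * N * C) * N⁻¹ ^ 2 := by
          gcongr
          exact hsum.trans (hbound.trans (by gcongr; exact hM hN))
      _ = 2 * C * N⁻¹ := by field_simp
  have hlim : Tendsto (fun N : ℝ => -((bernoulli' (s + 1) : ℝ) / ((s : ℝ) + 1))
      - bernoulli' (s + 2) * iteratedDeriv (s + 1) (fun x => x ^ s * η x) 0
          / (s + 2).factorial * N⁻¹ - R N) atTop
      (𝓝 (-((bernoulli' (s + 1) : ℝ) / ((s : ℝ) + 1)))) := by
    simpa using (tendsto_const_nhds.sub (tendsto_inv_atTop_zero.const_mul _)).sub hR0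
  refine hlim.congr' ?_
  filter_upwards [eventually_gt_atTop 0] with N hN
  exact (smoothed_sum_eq hη hη0 hηvanish s hN (by exact_mod_cast Nat.lt_floor_add_one N)).symm
end

section
/- (Tao's smoothed Euler–Maclaurin formula.) For every integer s ≥ 1 there exists a constant C_s > 0 with the following property: for every integer N ≥ 1 and every (s+2)-times continuously differentiable function f : ℝ → ℝ such that f and all its derivatives up to order s+1 vanish at the point N, one has |∫_0^N f(x) dx − (1/2) f(0) − ∑_{n=1}^N f(n) − ∑_{k=2}^{s+1} (B_k/k!) f^{(k−1)}(0)| ≤ C_s · N · sup_{x ∈ [0,N]} |f^{(s+2)}(x)|. -/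
open Filter Topology

theorem hasDerivAt_iteratedDeriv_of_contDiff {f : ℝ → ℝ} {n m : ℕ} (hf : ContDiff ℝ n f)
    (hm : m < n) (x : ℝ) : HasDerivAt (iteratedDeriv m f) (iteratedDeriv (m + 1) f x) x := by
  rw [iteratedDeriv_succ]
  exact (hf.differentiable_iteratedDeriv m (by exact_mod_cast hm) x).hasDerivAt

theorem integral_bernoulliFun_mul_iteratedDeriv {f : ℝ → ℝ} {m : ℕ} (hm : 1 ≤ m)
    (hf : ContDiff ℝ (m + 1 : ℕ) f) :
    ∫ x in (0 : ℝ)..1, bernoulliFun m x / m.factorial * iteratedDeriv m f x =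
      (bernoulli (m + 1) : ℝ) / (m + 1).factorial * (iteratedDeriv m f 1 - iteratedDeriv m f 0) -
      ∫ x in (0 : ℝ)..1,
        bernoulliFun (m + 1) x / (m + 1).factorial * iteratedDeriv (m + 1) f x := by
  have hB (x : ℝ) : HasDerivAt (fun x => bernoulliFun (m + 1) x / (m + 1).factorial)
      (bernoulliFun m x / m.factorial) x := by
    convert! (hasDerivAt_bernoulliFun (m + 1) x).div_const ((m + 1).factorial : ℝ) using 1
    rw [Nat.factorial_succ, Nat.add_sub_cancel]
    push_cast
    field_simp
  have h := intervalIntegral.integral_mul_deriv_eq_deriv_mul (a := 0) (b := 1)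
    (fun x _ => hB x) (fun x _ => hasDerivAt_iteratedDeriv_of_contDiff hf m.lt_succ_self x)
    (((continuous_bernoulliFun m).div_const _).intervalIntegrable _ _)
    ((hf.continuous_iteratedDeriv (m + 1) le_rfl).intervalIntegrable _ _)
  rw [h, bernoulliFun_endpoints_eq_of_ne_one (by lia), bernoulliFun_eval_zero]
  ring

/-- The Euler–Maclaurin formula on the unit interval. -/
theorem integral_unit_eq_euler_maclaurin {f : ℝ → ℝ} {m : ℕ} (hm : 1 ≤ m)
    (hf : ContDiff ℝ m f) :
    ∫ x in (0 : ℝ)..1, f x = (f 0 + f 1) / 2 -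
      ∑ k ∈ Finset.Icc 2 m, (bernoulli k : ℝ) / k.factorial *
        (iteratedDeriv (k - 1) f 1 - iteratedDeriv (k - 1) f 0) +
      (-1) ^ m * ∫ x in (0 : ℝ)..1, bernoulliFun m x / m.factorial * iteratedDeriv m f x := by
  induction m, hm using Nat.le_induction with
  | base =>
    have h := intervalIntegral.integral_mul_deriv_eq_deriv_mul (a := 0) (b := 1)
      (u := fun x : ℝ => x - 1 / 2) (u' := fun _ => 1)
      (fun x _ => (hasDerivAt_id x).sub_const _)
      (fun x _ => hasDerivAt_iteratedDeriv_of_contDiff hf one_pos x)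
      (continuous_const.intervalIntegrable _ _)
      ((hf.continuous_iteratedDeriv 1 le_rfl).intervalIntegrable _ _)
    simp only [zero_add, iteratedDeriv_zero, one_mul] at h
    simp only [bernoulliFun_one, Nat.factorial_one, Nat.cast_one, div_one, h]
    norm_num
    ring
  | succ m hm ih =>
    rw [ih (hf.of_le (by exact_mod_cast m.le_succ)), Finset.sum_Icc_succ_top (by lia),
      integral_bernoulliFun_mul_iteratedDeriv hm hf, Nat.add_sub_cancel]
    rcases Nat.even_or_odd m with h | h
    · rw [bernoulli_eq_zero_of_odd h.add_one (by lia), h.neg_one_pow, h.add_one.neg_one_pow]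
      simp
    · rw [h.neg_one_pow, h.add_one.neg_one_pow]
      ring

/-- The Euler–Maclaurin formula on `[0, N]`. -/
theorem integral_eq_euler_maclaurin {f : ℝ → ℝ} {m : ℕ} (hm : 1 ≤ m)
    (hf : ContDiff ℝ m f) (N : ℕ) :
    ∫ x in (0 : ℝ)..N, f x = (f 0 - f N) / 2 + ∑ n ∈ Finset.Icc 1 N, f n -
      ∑ k ∈ Finset.Icc 2 m, (bernoulli k : ℝ) / k.factorial *
        (iteratedDeriv (k - 1) f N - iteratedDeriv (k - 1) f 0) +
      (-1) ^ m * ∑ n ∈ Finset.range N,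
        ∫ x in (0 : ℝ)..1, bernoulliFun m x / m.factorial * iteratedDeriv m f (n + x) := by
  induction N with
  | zero => simp
  | succ N ih =>
    have h := integral_unit_eq_euler_maclaurin hm (f := fun x => f (N + x)) (by fun_prop)
    simp only [iteratedDeriv_comp_const_add, add_zero] at h
    rw [intervalIntegral.integral_comp_add_left, add_zero] at h
    rw [← intervalIntegral.integral_add_adjacent_intervals
      (hf.continuous.intervalIntegrable 0 N) (hf.continuous.intervalIntegrable N (N + 1 : ℕ)),
      ih, Finset.sum_Icc_succ_top (by lia), Finset.sum_range_succ]
    push_cast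
    rw [h]
    simp only [mul_sub, Finset.sum_sub_distrib]
    ring

theorem le_biSup_abs_Icc {g : ℝ → ℝ} (hg : Continuous g) {a b x : ℝ} (hx : x ∈ Set.Icc a b) :
    |g x| ≤ ⨆ y ∈ Set.Icc a b, |g y| := by
  obtain ⟨C, hC⟩ := isCompact_Icc.bddAbove_image (K := Set.Icc a b) hg.abs.continuousOn
  have hC0 : 0 ≤ C := (abs_nonneg _).trans (hC ⟨x, hx, rfl⟩)
  refine le_ciSup_of_le ⟨C, ?_⟩ x (by rw [ciSup_pos hx])
  rintro _ ⟨y, rfl⟩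
  exact Real.iSup_le (fun hy => hC ⟨y, hy, rfl⟩) hC0

/-- Tao's smoothed Euler–Maclaurin formula: for every integer `s ≥ 1` there is `C_s > 0`
such that for every integer `N ≥ 1` and every `(s+2)`-times continuously differentiable
`f : ℝ → ℝ` whose derivatives up to order `s+1` all vanish at `N`,
`|∫_0^N f - (1/2) f 0 - ∑_{n=1}^N f n - ∑_{k=2}^{s+1} (B_k/k!) f^{(k-1)}(0)|
  ≤ C_s · N · sup_{x ∈ [0,N]} |f^{(s+2)}(x)|`. -/
theorem tao_euler_maclaurin (s : ℕ) (hs : 1 ≤ s) :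
    ∃ C : ℝ, 0 < C ∧ ∀ N : ℕ, 1 ≤ N → ∀ f : ℝ → ℝ,
      ContDiff ℝ (↑(s + 2)) f →
      (∀ k ≤ s + 1, iteratedDeriv k f (N : ℝ) = 0) →
      |(∫ x in (0 : ℝ)..(N : ℝ), f x) - (1 / 2) * f 0 - (∑ n ∈ Finset.Icc 1 N, f (n : ℝ))
          - ∑ k ∈ Finset.Icc 2 (s + 1),
              ((bernoulli k : ℝ) / (Nat.factorial k : ℝ)) * iteratedDeriv (k - 1) f 0|
        ≤ C * (N : ℝ) * ⨆ x ∈ Set.Icc (0 : ℝ) (N : ℝ), |iteratedDeriv (s + 2) f x| := by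
 
  obtain ⟨A, hA⟩ := isCompact_Icc.bddAbove_image (K := Set.Icc (0 : ℝ) 1)
    (((continuous_bernoulliFun (s + 2)).div_const ((s + 2).factorial : ℝ)).abs.continuousOn)
  replace hA (x : ℝ) (hx : x ∈ Set.Icc (0 : ℝ) 1) :
      |bernoulliFun (s + 2) x / (s + 2).factorial| ≤ A := hA ⟨x, hx, rfl⟩
  have hA0 : 0 ≤ A := (abs_nonneg _).trans (hA 0 (by simp))
  refine ⟨2 * A + 1, by positivity, fun N _ f hf hN => ?_⟩
  set M := ⨆ x ∈ Set.Icc (0 : ℝ) (N : ℝ), |iteratedDeriv (s + 2) f x|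
  have hcont := hf.continuous_iteratedDeriv (s + 2) le_rfl
  have hM (x : ℝ) (hx : x ∈ Set.Icc (0 : ℝ) N) : |iteratedDeriv (s + 2) f x| ≤ M :=
    le_biSup_abs_Icc hcont hx
  have hM0 : 0 ≤ M := (abs_nonneg _).trans (hM 0 (by simp))
  have hboundary : |iteratedDeriv (s + 1) f 0| ≤ N * M := by
    have h := intervalIntegral.integral_eq_sub_of_hasDerivAt (a := 0) (b := N)
      (fun x _ => hasDerivAt_iteratedDeriv_of_contDiff hf (m := s + 1) (by lia) x)
      (hcont.intervalIntegrable _ _)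
    rw [hN _ le_rfl, zero_sub] at h
    rw [← abs_neg, ← h, ← Real.norm_eq_abs]
    refine (intervalIntegral.norm_integral_le_of_norm_le_const (C := M) fun x hx => ?_).trans ?_
    · rw [Set.uIoc_of_le N.cast_nonneg] at hx
      exact hM x ⟨hx.1.le, hx.2⟩
    · simp [mul_comm]
  have hremainder (n : ℕ) (hn : n ∈ Finset.range N) :
      |∫ x in (0 : ℝ)..1, bernoulliFun (s + 2) x / (s + 2).factorial *
        iteratedDeriv (s + 2) f (n + x)| ≤ A * M := by
    rw [← Real.norm_eq_abs]
    refine (intervalIntegral.norm_integral_le_of_norm_le_const (C := A * M) fun x hx => ?_).trans ?_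
    · rw [Set.uIoc_of_le zero_le_one] at hx
      have hn' : (n : ℝ) + 1 ≤ N := by exact_mod_cast Finset.mem_range.mp hn
      rw [norm_mul]
      exact mul_le_mul (hA x ⟨hx.1.le, hx.2⟩)
        (hM _ ⟨add_nonneg n.cast_nonneg hx.1.le, by linarith [hx.2]⟩) (norm_nonneg _) hA0
    · simp
  have hsum := (Finset.abs_sum_le_sum_abs _ _).trans (Finset.sum_le_sum hremainder)
  rw [Finset.sum_const, Finset.card_range, nsmul_eq_mul] at hsum
  have hvanish : ∑ k ∈ Finset.Icc 2 (s + 2), (bernoulli k : ℝ) / k.factorial *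
      (iteratedDeriv (k - 1) f N - iteratedDeriv (k - 1) f 0) =
      -∑ k ∈ Finset.Icc 2 (s + 2), (bernoulli k : ℝ) / k.factorial *
        iteratedDeriv (k - 1) f 0 := by
    rw [← Finset.sum_neg_distrib]
    refine Finset.sum_congr rfl fun k hk => ?_
    rw [hN (k - 1) (by have := (Finset.mem_Icc.mp hk).2; lia)]
    ring
  have hfN : f N = 0 := by simpa using hN 0 (by lia)
  rw [integral_eq_euler_maclaurin (by lia) hf N, hvanish, hfN,
    Finset.sum_Icc_succ_top (b := s + 1) (by lia)]
  set R := ∑ n ∈ Finset.range N, ∫ x in (0 : ℝ)..1,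
    bernoulliFun (s + 2) x / (s + 2).factorial * iteratedDeriv (s + 2) f (n + x)
  calc _ = |(bernoulli (s + 2) : ℝ) / (s + 2).factorial * iteratedDeriv (s + 1) f 0 +
        (-1) ^ (s + 2) * R| := by
        congr 1
        simp only [Nat.add_assoc, Nat.reduceAdd, Nat.reduceSubDiff]
        ring
    _ ≤ A * (N * M) + N * (A * M) := by
        refine (abs_add_le _ _).trans (add_le_add ?_ ?_)
        · rw [abs_mul, ← bernoulliFun_eval_zero]
          exact mul_le_mul (hA 0 (by simp)) hboundary (abs_nonneg _) hA0
        · rwa [abs_mul, abs_pow, abs_neg, abs_one, one_pow, one_mul]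
    _ ≤ (2 * A + 1) * N * M := by
        have : 0 ≤ (N : ℝ) * M := by positivity
        linarith
end

section
/- Let η : ℝ → ℝ be a cutoff function and let s be a natural number. Then there exists a constant C > 0 such that for all real N ≥ 1, the function f_N(x) = x^s η(x/N) satisfies sup_{x ≥ 0} |f_N^{(s+2)}(x)| ≤ C/N². -/
open Filter Topology

/-- An iterated derivative of a smooth function vanishing on `[1, ∞)` is bounded on `[0, ∞)`. -/
theorem exists_forall_abs_iteratedDeriv_le {g : ℝ → ℝ} (hg : ContDiff ℝ (⊤ : ℕ∞) g)
    (hvanish : ∀ x : ℝ, 1 ≤ x → g x = 0) (n : ℕ) :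
    ∃ C : ℝ, 0 < C ∧ ∀ x : ℝ, 0 ≤ x → |iteratedDeriv n g x| ≤ C := by
  have hcont : Continuous (iteratedDeriv n g) :=
    hg.continuous_iteratedDeriv n (by exact_mod_cast le_top)
  obtain ⟨M, hM⟩ := (isCompact_Icc (a := (0 : ℝ)) (b := 1)).exists_bound_of_continuousOn
    hcont.continuousOn
  refine ⟨max M 1, by positivity, fun x hx => ?_⟩
  rcases le_or_gt x 1 with h | h
  · exact (hM x ⟨hx, h⟩).trans (le_max_left _ _)
  · have hzero : g =ᶠ[𝓝 x] fun _ => 0 := by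
      filter_upwards [lt_mem_nhds h] with y hy using hvanish y hy.le
    rw [hzero.iteratedDeriv_eq n]
    simp

/-- Scaling identity for the derivatives of `y ^ s * η (y / N)`. -/
theorem iteratedDeriv_pow_mul_comp_div {η : ℝ → ℝ} (hη : ContDiff ℝ (⊤ : ℕ∞) η) (s k : ℕ)
    {N : ℝ} (hN : N ≠ 0) (x : ℝ) :
    iteratedDeriv (s + k) (fun y : ℝ => y ^ s * η (y / N)) x =
      iteratedDeriv (s + k) (fun u : ℝ => u ^ s * η u) (x / N) / N ^ k := by
  have hg : ContDiff ℝ (⊤ : ℕ∞) (fun u : ℝ => u ^ s * η u) := (contDiff_id.pow s).mul hη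
  have hf : (fun y : ℝ => y ^ s * η (y / N)) =
      fun y => N ^ s * (fun u : ℝ => u ^ s * η u) (N⁻¹ * y) := by
    funext y
    simp only [div_eq_inv_mul, mul_pow, inv_pow]
    field_simp
  have hg' : ContDiff ℝ ((s + k : ℕ) : WithTop ℕ∞) (fun u : ℝ => u ^ s * η u) :=
    hg.of_le (by exact_mod_cast le_top)
  rw [hf, iteratedDeriv_const_mul_field, iteratedDeriv_comp_const_mul hg']
  simp only [div_eq_inv_mul, inv_pow, pow_add]
  field_simp

/-- For a cutoff function `η` and `s : ℕ`, there is `C > 0` such that for all real `N ≥ 1`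
the function `f_N(x) = x^s η(x/N)` satisfies `sup_{x ≥ 0} |f_N^{(s+2)}(x)| ≤ C / N²`. -/
theorem smoothed_monomial_derivative_bound (η : ℝ → ℝ) (hη : ContDiff ℝ (⊤ : ℕ∞) η) (hη0 : η 0 = 1)
    (hηvanish : ∀ x : ℝ, 1 ≤ x → η x = 0) (s : ℕ) :
    ∃ C : ℝ, 0 < C ∧ ∀ N : ℝ, 1 ≤ N →
      (⨆ x ∈ Set.Ici (0 : ℝ), |iteratedDeriv (s + 2) (fun y : ℝ => y ^ s * η (y / N)) x|)
        ≤ C / N ^ 2 := by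
  obtain ⟨C, hC, hbound⟩ := exists_forall_abs_iteratedDeriv_le
    (g := fun u : ℝ => u ^ s * η u) ((contDiff_id.pow s).mul hη)
    (fun x hx => by simp [hηvanish x hx]) (s + 2)
  refine ⟨C, hC, fun N hN => ?_⟩
  have hN0 : 0 < N := by linarith
  have hnonneg : 0 ≤ C / N ^ 2 := by positivity
  refine Real.iSup_le (fun x => Real.iSup_le (fun hx => ?_) hnonneg) hnonneg
  rw [iteratedDeriv_pow_mul_comp_div hη s 2 hN0.ne' x, abs_div, abs_of_pos (pow_pos hN0 2)]
  gcongr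
  exact hbound _ (div_nonneg hx hN0.le)
end

section
/- (Casimir energy of perfectly conducting parallel plates via smoothed sums.) Let η : ℝ → ℝ be a cutoff function and let λ > 0 be a real number. For real N ≥ 1 define F_N(s) = ∫_s^∞ v² η(λv/N) dv for s ≥ 0, and set u_N = ∑_{n=1}^∞ F_N(n) + (1/2) F_N(0) − ∫_0^∞ F_N(s) ds. Then lim_{N→∞} u_N = −1/360. Consequently, for any positive reals ħ, c, d, the total Casimir energy per unit surface u^t = (π²ħc/(2d³)) · lim_{N→∞} u_N equals −π²ħc/(720 d³). -/
open Filter Topology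

/-- `casimirF η lam N s = ∫_s^∞ v² η(lam·v/N) dv`. -/
noncomputable def casimirF (η : ℝ → ℝ) (lam N s : ℝ) : ℝ :=
  ∫ v in Set.Ioi s, v ^ 2 * η (lam * v / N)

/-- The smoothed total energy sum
`u_N = ∑_{n=1}^∞ F_N(n) + (1/2) F_N(0) - ∫_0^∞ F_N(s) ds`. -/
noncomputable def casimirU (η : ℝ → ℝ) (lam N : ℝ) : ℝ :=
  (∑' n : ℕ, casimirF η lam N ((n : ℝ) + 1)) + (1 / 2) * casimirF η lam N 0
    - ∫ s in Set.Ioi (0 : ℝ), casimirF η lam N s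

/-- Euler–Maclaurin formula of order five on a unit interval, with an error bound. -/
theorem abs_trapezoid_sub_integral_le {D : ℕ → ℝ → ℝ}
    (hD : ∀ k < 5, ∀ x, HasDerivAt (D k) (D (k + 1) x) x) (hc : Continuous (D 5)) (a C : ℝ)
    (hC : ∀ x ∈ Set.Icc a (a + 1), |D 5 x| ≤ C) :
    |(D 0 a + D 0 (a + 1)) / 2 - (∫ x in a..(a + 1), D 0 x)
      - (D 1 (a + 1) - D 1 a) / 12 + (D 3 (a + 1) - D 3 a) / 720| ≤ C := by
  -- `P` is the fifth Bernoulli polynomial divided by `5!`.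
  set P : ℝ → ℝ := fun y => (y ^ 5 - 5 / 2 * y ^ 4 + 5 / 3 * y ^ 3 - y / 6) / 120 with hP
  have hPc : Continuous P := by fun_prop
  have h0 : Continuous (D 0) :=
    continuous_iff_continuousAt.2 fun x => (hD 0 (by norm_num) x).continuousAt
  have hderiv : ∀ x, HasDerivAt (fun x =>
      (x - a - 1 / 2) * D 0 x - ((x - a) ^ 2 - (x - a) + 1 / 6) / 2 * D 1 x
      + ((x - a) ^ 3 - 3 / 2 * (x - a) ^ 2 + (x - a) / 2) / 6 * D 2 x
      - ((x - a) ^ 4 - 2 * (x - a) ^ 3 + (x - a) ^ 2 - 1 / 30) / 24 * D 3 x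
      + P (x - a) * D 4 x) (D 0 x + P (x - a) * D 5 x) x := by
    intro x
    have hy : HasDerivAt (fun x : ℝ => x - a) 1 x := (hasDerivAt_id x).sub_const a
    have h2 := hy.fun_pow 2
    have h3 := hy.fun_pow 3
    have h4 := hy.fun_pow 4
    have h5 := hy.fun_pow 5
    have t0 := (hy.sub_const (1 / 2)).fun_mul (hD 0 (by norm_num) x)
    have t1 := (((h2.fun_sub hy).add_const (1 / 6)).div_const 2).fun_mul (hD 1 (by norm_num) x)
    have t2 := (((h3.fun_sub (h2.const_mul (3 / 2))).fun_add (hy.div_const 2)).div_const 6).fun_mul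
      (hD 2 (by norm_num) x)
    have t3 := ((((h4.fun_sub (h3.const_mul 2)).fun_add h2).sub_const (1 / 30)).div_const 24).fun_mul
      (hD 3 (by norm_num) x)
    have t4 := ((((h5.fun_sub (h4.const_mul (5 / 2))).fun_add (h3.const_mul (5 / 3))).fun_sub
      (hy.div_const 6)).div_const 120).fun_mul (hD 4 (by norm_num) x)
    refine ((((t0.fun_sub t1).fun_add t2).fun_sub t3).fun_add t4).congr_deriv ?_
    simp only [hP]
    push_cast
    ring
  have hint : Continuous fun x => P (x - a) * D 5 x := by fun_prop
  have hftc := intervalIntegral.integral_eq_sub_of_hasDerivAt (a := a) (b := a + 1)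
    (fun x _ => hderiv x) ((h0.add hint).intervalIntegrable _ _)
  rw [intervalIntegral.integral_add (h0.intervalIntegrable _ _) (hint.intervalIntegrable _ _)]
    at hftc
  have hrem : |∫ x in a..(a + 1), P (x - a) * D 5 x| ≤ C := by
    have := intervalIntegral.norm_integral_le_of_norm_le_const (a := a) (b := a + 1) (C := C)
      (f := fun x => P (x - a) * D 5 x) ?_
    · simpa using this
    · intro x hx
      rw [Set.uIoc_of_le (by linarith)] at hx
      have hPx : |P (x - a)| ≤ 1 := by
        have hy0 : 0 ≤ x - a := by linarith [hx.1]
        have hy1 : x - a ≤ 1 := by linarith [hx.2]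
        have b3 := pow_le_one₀ (n := 3) hy0 hy1
        have b4 := pow_le_one₀ (n := 4) hy0 hy1
        have b5 := pow_le_one₀ (n := 5) hy0 hy1
        have c3 := pow_nonneg hy0 3
        have c4 := pow_nonneg hy0 4
        have c5 := pow_nonneg hy0 5
        rw [abs_le]
        constructor <;> simp only [hP] <;> linarith
      rw [Real.norm_eq_abs, abs_mul]
      calc |P (x - a)| * |D 5 x| ≤ 1 * |D 5 x| := by gcongr
        _ ≤ C := by simpa using hC x ⟨hx.1.le, hx.2⟩
  convert hrem using 2
  generalize ∫ x in a..(a + 1), P (x - a) * D 5 x = R at hftc ⊢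
  simp only [hP, add_sub_cancel_left, sub_self] at hftc
  linarith

/-- Euler–Maclaurin formula of order five on `[0, M]`, with an error bound. -/
theorem abs_sum_sub_integral_le {D : ℕ → ℝ → ℝ}
    (hD : ∀ k < 5, ∀ x, HasDerivAt (D k) (D (k + 1) x) x) (hc : Continuous (D 5)) (C : ℝ)
    (M : ℕ) (hC : ∀ x ∈ Set.Icc (0 : ℝ) M, |D 5 x| ≤ C) :
    |(∑ n ∈ Finset.range M, D 0 ((n : ℝ) + 1)) + D 0 0 / 2 - D 0 M / 2
      - (∫ x in (0 : ℝ)..M, D 0 x) - (D 1 M - D 1 0) / 12 + (D 3 M - D 3 0) / 720| ≤ M * C := by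
  have h0 : Continuous (D 0) :=
    continuous_iff_continuousAt.2 fun x => (hD 0 (by norm_num) x).continuousAt
  induction M with
  | zero => simp
  | succ m ih =>
    push_cast at hC ⊢
    have ih' := ih fun x hx => hC x ⟨hx.1, by linarith [hx.2]⟩
    have hm : (0 : ℝ) ≤ m := m.cast_nonneg
    have hstep := abs_trapezoid_sub_integral_le hD hc m C
      fun x hx => hC x ⟨hm.trans hx.1, hx.2⟩
    rw [Finset.sum_range_succ, ← intervalIntegral.integral_add_adjacent_intervals
      (h0.intervalIntegrable 0 (m : ℝ)) (h0.intervalIntegrable (m : ℝ) (m + 1))]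
    rw [abs_le] at *
    constructor <;> linarith [ih'.1, ih'.2, hstep.1, hstep.2]

theorem iteratedDeriv_eq_zero_of_forall_le_s5 {G : ℝ → ℝ} {b : ℝ} (hG : ∀ x, b ≤ x → G x = 0) (k : ℕ)
    {x : ℝ} (hx : b < x) : iteratedDeriv k G x = 0 := by
  have h : G =ᶠ[𝓝 x] fun _ => 0 := by
    filter_upwards [lt_mem_nhds hx] with y hy using hG y hy.le
  rw [h.iteratedDeriv_eq k]
  simp

theorem ContDiff.hasDerivAt_iteratedDeriv {G : ℝ → ℝ} (hG : ContDiff ℝ (⊤ : ℕ∞) G) (k : ℕ) (x : ℝ) :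
    HasDerivAt (iteratedDeriv k G) (iteratedDeriv (k + 1) G x) x := by
  rw [iteratedDeriv_succ]
  exact (hG.differentiable_iteratedDeriv k (mod_cast ENat.natCast_lt_top k) x).hasDerivAt

theorem ContDiff.continuous_iteratedDeriv_of_top {G : ℝ → ℝ} (hG : ContDiff ℝ (⊤ : ℕ∞) G) (k : ℕ) :
    Continuous (iteratedDeriv k G) :=
  continuous_iff_continuousAt.2 fun x => (hG.hasDerivAt_iteratedDeriv k x).continuousAt

theorem iteratedDeriv_two_sq_mul {η : ℝ → ℝ} (hη : ContDiff ℝ (⊤ : ℕ∞) η) :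
    iteratedDeriv 2 (fun x => x ^ 2 * η x) 0 = 2 * η 0 := by
  have h (x : ℝ) : HasDerivAt η (deriv η x) x := by
    simpa using hη.hasDerivAt_iteratedDeriv 0 x
  have h' (x : ℝ) : HasDerivAt (deriv η) (iteratedDeriv 2 η x) x := by
    simpa using hη.hasDerivAt_iteratedDeriv 1 x
  have h1 : deriv (fun x => x ^ 2 * η x) = fun x => 2 * x * η x + x ^ 2 * deriv η x := by
    ext x
    simpa using ((hasDerivAt_pow 2 x).fun_mul (h x)).deriv
  rw [iteratedDeriv_succ, iteratedDeriv_one, h1]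
  have h2 := ((((hasDerivAt_id (0 : ℝ)).const_mul 2).fun_mul (h 0)).fun_add
    ((hasDerivAt_pow 2 (0 : ℝ)).fun_mul (h' 0))).deriv
  simpa using h2

theorem casimirF_eq_zero {η : ℝ → ℝ} (hηvanish : ∀ x : ℝ, 1 ≤ x → η x = 0) {lam N s : ℝ}
    (hs : 1 ≤ lam / N * s) (hε : 0 < lam / N) : casimirF η lam N s = 0 := by
  refine MeasureTheory.setIntegral_eq_zero_of_forall_eq_zero fun v hv => ?_
  have hv' : 1 ≤ lam * v / N := by
    calc 1 ≤ lam / N * s := hs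
      _ ≤ lam / N * v := by gcongr; exact (Set.mem_Ioi.1 hv).le
      _ = lam * v / N := by ring
  rw [hηvanish _ hv', mul_zero]

theorem hasDerivAt_casimirF {η : ℝ → ℝ} (hη : Continuous η)
    (hηvanish : ∀ x : ℝ, 1 ≤ x → η x = 0) {lam N : ℝ} (hε : 0 < lam / N) (s : ℝ) :
    HasDerivAt (casimirF η lam N) (-(s ^ 2 * η (lam * s / N))) s := by
  have hc : Continuous fun v : ℝ => v ^ 2 * η (lam * v / N) := by fun_prop
  have hi (a : ℝ) : MeasureTheory.IntegrableOn (fun v : ℝ => v ^ 2 * η (lam * v / N))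
      (Set.Ioi a) := by
    refine MeasureTheory.IntegrableOn.of_forall_sdiff_eq_zero
      (hc.integrableOn_Icc (a := a) (b := 1 / (lam / N))) measurableSet_Ioi fun v hv => ?_
    have hv' : 1 / (lam / N) < v := by
      by_contra! h
      exact hv.2 ⟨hv.1.le, h⟩
    rw [div_lt_iff₀ hε] at hv'
    rw [hηvanish _ (by linarith [show lam * v / N = v * (lam / N) by ring]), mul_zero]
  have hF : casimirF η lam N =
      fun s => casimirF η lam N 0 - ∫ v in (0 : ℝ)..s, v ^ 2 * η (lam * v / N) := by
    ext s
    rw [← intervalIntegral.integral_Ioi_sub_Ioi' (hi 0) (hi s)]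
    simp [casimirF]
  rw [hF]
  exact (intervalIntegral.integral_hasDerivAt_right (hc.intervalIntegrable _ _)
    (hc.stronglyMeasurableAtFilter _ _) hc.continuousAt).const_sub _

theorem casimirU_eq {η : ℝ → ℝ} (hηvanish : ∀ x : ℝ, 1 ≤ x → η x = 0) {lam N : ℝ}
    (hε : 0 < lam / N) {M : ℕ} (hM : 1 ≤ lam / N * M) :
    casimirU η lam N = (∑ n ∈ Finset.range M, casimirF η lam N ((n : ℝ) + 1))
      + casimirF η lam N 0 / 2 - ∫ s in (0 : ℝ)..M, casimirF η lam N s := by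
  have hzero {s : ℝ} (hs : (M : ℝ) ≤ s) : casimirF η lam N s = 0 :=
    casimirF_eq_zero hηvanish (hM.trans (by gcongr)) hε
  have hsum : ∑' n : ℕ, casimirF η lam N ((n : ℝ) + 1) =
      ∑ n ∈ Finset.range M, casimirF η lam N ((n : ℝ) + 1) := by
    refine tsum_eq_sum fun n hn => hzero ?_
    have : (M : ℝ) ≤ n := by exact_mod_cast not_lt.1 (mt Finset.mem_range.2 hn)
    linarith
  have hint : ∫ s in Set.Ioi (0 : ℝ), casimirF η lam N s =
      ∫ s in (0 : ℝ)..M, casimirF η lam N s := by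
    rw [intervalIntegral.integral_of_le M.cast_nonneg]
    refine MeasureTheory.setIntegral_eq_of_subset_of_forall_sdiff_eq_zero measurableSet_Ioi
      Set.Ioc_subset_Ioi_self fun s hs => hzero ?_
    by_contra! h
    exact hs.2 ⟨hs.1, h.le⟩
  rw [casimirU, hsum, hint]
  ring

theorem abs_casimirU_add_le {η : ℝ → ℝ} (hη : ContDiff ℝ (⊤ : ℕ∞) η) (hη0 : η 0 = 1)
    (hηvanish : ∀ x : ℝ, 1 ≤ x → η x = 0) {C : ℝ}
    (hC : ∀ x ∈ Set.Icc (0 : ℝ) 2, |iteratedDeriv 4 (fun x => x ^ 2 * η x) x| ≤ C) {lam N : ℝ}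
    (hε : 0 < lam / N) (hε1 : lam / N ≤ 1) :
    |casimirU η lam N + 1 / 360| ≤ 2 * C * (lam / N) := by
  set G : ℝ → ℝ := fun x => x ^ 2 * η x with hG
  have hGs : ContDiff ℝ (⊤ : ℕ∞) G := by fun_prop
  have hGvanish (x : ℝ) (hx : 1 ≤ x) : G x = 0 := by simp [hG, hηvanish x hx]
  set ε := lam / N with hεdef
  set M : ℕ := ⌊1 / ε⌋₊ + 1 with hMdef
  have hM1 : 1 < ε * M := by
    have : 1 / ε < M := by simpa [hMdef] using Nat.lt_floor_add_one (1 / ε)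
    rw [div_lt_iff₀ hε] at this
    linarith
  have hM2 : ε * M ≤ 2 := by
    have : (M : ℝ) ≤ 1 / ε + 1 := by
      simpa [hMdef] using Nat.floor_le (show 0 ≤ 1 / ε by positivity)
    calc ε * M ≤ ε * (1 / ε + 1) := by gcongr
      _ = 1 + ε := by field_simp
      _ ≤ 2 := by linarith
  set D : ℕ → ℝ → ℝ := fun k => match k with
    | 0 => casimirF η lam N
    | k + 1 => fun x => -(ε ^ k / ε ^ 2 * iteratedDeriv k G (ε * x)) with hDdef
  have hD : ∀ k < 5, ∀ x, HasDerivAt (D k) (D (k + 1) x) x := by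
    rintro (_ | k) - x
    · refine (hasDerivAt_casimirF hη.continuous hηvanish hε x).congr_deriv ?_
      have : lam * x / N = ε * x := by rw [hεdef]; ring
      simp only [hDdef, hG, this, iteratedDeriv_zero]
      field_simp
    · have hlin : HasDerivAt (fun x => ε * x) ε x := by
        simpa using (hasDerivAt_id x).const_mul ε
      refine (((hGs.hasDerivAt_iteratedDeriv k (ε * x)).comp x hlin).const_mul
        (ε ^ k / ε ^ 2)).fun_neg.congr_deriv ?_
      simp only [hDdef]
      ring
  have hD5 : Continuous (D 5) := by
    have := hGs.continuous_iteratedDeriv_of_top 4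
    simp only [hDdef]
    fun_prop
  have hbound : ∀ x ∈ Set.Icc (0 : ℝ) M, |D 5 x| ≤ ε ^ 2 * C := by
    intro x hx
    have h := hC (ε * x) ⟨mul_nonneg hε.le hx.1, le_trans (by gcongr; exact hx.2) hM2⟩
    have : D 5 x = -(ε ^ 2 * iteratedDeriv 4 G (ε * x)) := by
      simp only [hDdef]
      field_simp
    rw [this, abs_neg, abs_mul, abs_of_nonneg (by positivity)]
    gcongr
  have key := abs_sum_sub_integral_le hD hD5 (ε ^ 2 * C) M hbound
  have e0 : D 0 M = 0 := casimirF_eq_zero hηvanish hM1.le hε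
  have e1 : D 1 M = 0 := by
    simp [hDdef, hGvanish _ hM1.le]
  have e3 : D 3 M = 0 := by
    simp [hDdef, iteratedDeriv_eq_zero_of_forall_le_s5 hGvanish 2 hM1]
  have e1' : D 1 0 = 0 := by simp [hDdef, hG]
  have e3' : D 3 0 = -2 := by
    simp only [hDdef, mul_zero, hG, iteratedDeriv_two_sq_mul hη, hη0]
    field_simp
  rw [e0, e1, e3, e1', e3'] at key
  have hU := casimirU_eq hηvanish hε hM1.le
  have hC0 : 0 ≤ C := (abs_nonneg _).trans (hC 0 (by norm_num))
  calc |casimirU η lam N + 1 / 360| ≤ M * (ε ^ 2 * C) := by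
        rw [hU]
        convert key using 2
        simp only [hDdef]
        ring
    _ = (ε * M) * (C * ε) := by ring
    _ ≤ 2 * (C * ε) := by gcongr
    _ = 2 * C * ε := by ring

/-- Casimir energy of perfectly conducting parallel plates via smoothed sums:
for a cutoff function `η` and `λ > 0`, `lim_{N→∞} u_N = -1/360`; consequently, for any
positive `ħ, c, d`, the total Casimir energy per unit surface
`u^t = (π²ħc/(2d³)) · lim_{N→∞} u_N` equals `-π²ħc/(720 d³)`. -/
theorem casimir_parallel_plates (η : ℝ → ℝ) (hη : ContDiff ℝ (⊤ : ℕ∞) η) (hη0 : η 0 = 1)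
    (hηvanish : ∀ x : ℝ, 1 ≤ x → η x = 0) (lam : ℝ) (hlam : 0 < lam) :
    Tendsto (fun N : ℝ => casimirU η lam N) atTop (𝓝 (-1 / 360)) ∧
    ∀ hbar c d : ℝ, 0 < hbar → 0 < c → 0 < d →
      Tendsto (fun N : ℝ => (Real.pi ^ 2 * hbar * c / (2 * d ^ 3)) * casimirU η lam N)
        atTop (𝓝 (-(Real.pi ^ 2 * hbar * c) / (720 * d ^ 3))) := by
  have hlim : Tendsto (fun N : ℝ => casimirU η lam N) atTop (𝓝 (-1 / 360)) := by
    have hGs : ContDiff ℝ (⊤ : ℕ∞) fun x => x ^ 2 * η x := by fun_prop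
    obtain ⟨C, hC⟩ := (isCompact_Icc (a := (0 : ℝ)) (b := 2)).exists_bound_of_continuousOn
      (hGs.continuous_iteratedDeriv_of_top 4).continuousOn
    rw [tendsto_iff_norm_sub_tendsto_zero]
    refine squeeze_zero' (g := fun N => 2 * C * (lam / N))
      (Eventually.of_forall fun _ => norm_nonneg _) ?_ ?_
    · filter_upwards [eventually_ge_atTop lam] with N hN
      have hN0 : 0 < N := hlam.trans_le hN
      have h := abs_casimirU_add_le hη hη0 hηvanish hC (div_pos hlam hN0)
        ((div_le_one hN0).2 hN)
      rw [Real.norm_eq_abs]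
      convert h using 2
      ring
    · simpa using (tendsto_const_nhds (x := lam)).div_atTop tendsto_id |>.const_mul (2 * C)
  refine ⟨hlim, fun hbar c d _ _ hd => ?_⟩
  convert hlim.const_mul (Real.pi ^ 2 * hbar * c / (2 * d ^ 3)) using 2
  field_simp
  norm_num
end

section
/- (Stirling series with remainder bound.) For every real x > 0 and every integer N ≥ 1, |log Γ(x) − (x − 1/2) log x + x − (1/2) log(2π) − ∑_{m=1}^N B_{2m} / (2m (2m−1) x^{2m−1})| ≤ |B_{2N+2}| / ((2N+1)(2N+2) x^{2N+1}), where Γ is the Gamma function: the error after truncating the (divergent) Stirling asymptotic series is bounded by the magnitude of the first omitted term. -/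
open Filter Topology

/-- Integration by parts, raising the index of the Bernoulli polynomial; `c` is the constant of
integration. -/
theorem integral_bernoulliFun_div_pow {k : ℕ} (hk : k ≠ 0) {y : ℝ} (hy : 0 < y) (c : ℝ) :
    ∫ t in (0 : ℝ)..1, bernoulliFun k t / (y + t) ^ k =
      (bernoulli (k + 1) - c) / (k + 1) * (((y + 1) ^ k)⁻¹ - (y ^ k)⁻¹) +
        k / (k + 1) * ∫ t in (0 : ℝ)..1, (bernoulliFun (k + 1) t - c) / (y + t) ^ (k + 1) := by
  have hpos : ∀ t ∈ Set.uIcc (0 : ℝ) 1, y + t ≠ 0 := fun t ht => by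
    rw [Set.uIcc_of_le zero_le_one] at ht
    linarith [ht.1]
  have hderiv : ∀ t ∈ Set.uIcc (0 : ℝ) 1,
      HasDerivAt (fun t => (bernoulliFun (k + 1) t - c) / (k + 1) * ((y + t) ^ k)⁻¹)
        (bernoulliFun k t / (y + t) ^ k -
          k / (k + 1) * ((bernoulliFun (k + 1) t - c) / (y + t) ^ (k + 1))) t := fun t ht => by
    have hne := hpos t ht
    have h := (((hasDerivAt_bernoulliFun (k + 1) t).sub_const c).div_const ((k : ℝ) + 1)).mul
      ((((hasDerivAt_id t).const_add y).pow k).inv (pow_ne_zero k hne))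
    refine h.congr_deriv ?_
    obtain ⟨j, rfl⟩ := Nat.exists_eq_succ_of_ne_zero hk
    simp only [Nat.succ_eq_add_one, add_tsub_cancel_right, id_eq, Pi.pow_apply, Pi.inv_apply]
    push_cast
    field_simp
    ring
  have hcont₁ : IntervalIntegrable (fun t => bernoulliFun k t / (y + t) ^ k)
      MeasureTheory.volume 0 1 :=
    ((continuous_bernoulliFun k).continuousOn.div (by fun_prop)
      fun t ht => pow_ne_zero _ (hpos t ht)).intervalIntegrable
  have hcont₂ : IntervalIntegrable
      (fun t => k / (k + 1) * ((bernoulliFun (k + 1) t - c) / (y + t) ^ (k + 1)))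
      MeasureTheory.volume 0 1 :=
    ((((continuous_bernoulliFun (k + 1)).sub continuous_const).continuousOn.div (by fun_prop)
      fun t ht => pow_ne_zero _ (hpos t ht)).intervalIntegrable).const_mul _
  have h := intervalIntegral.integral_eq_sub_of_hasDerivAt hderiv (hcont₁.sub hcont₂)
  rw [intervalIntegral.integral_sub hcont₁ hcont₂, intervalIntegral.integral_const_mul,
    bernoulliFun_endpoints_eq_of_ne_one (by lia), bernoulliFun_eval_zero, add_zero] at h
  linear_combination h

theorem integral_bernoulliFun_one_div {y : ℝ} (hy : 0 < y) :
    ∫ t in (0 : ℝ)..1, bernoulliFun 1 t / (y + t) ^ 1 =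
      1 - (y + 1 / 2) * (Real.log (y + 1) - Real.log y) := by
  have hpos : ∀ t ∈ Set.uIcc (0 : ℝ) 1, y + t ≠ 0 := fun t ht => by
    rw [Set.uIcc_of_le zero_le_one] at ht
    linarith [ht.1]
  have hderiv : ∀ t ∈ Set.uIcc (0 : ℝ) 1,
      HasDerivAt (fun t => t - (y + 1 / 2) * Real.log (y + t))
        (bernoulliFun 1 t / (y + t) ^ 1) t := fun t ht => by
    have hne := hpos t ht
    have h := (hasDerivAt_id t).sub
      ((((hasDerivAt_id t).const_add y).log hne).const_mul (y + 1 / 2))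
    refine h.congr_deriv ?_
    simp only [id_eq, bernoulliFun_one]
    field_simp
    ring
  rw [intervalIntegral.integral_eq_sub_of_hasDerivAt hderiv
    ((continuous_bernoulliFun 1).continuousOn.div (by fun_prop)
      fun t ht => pow_ne_zero _ (hpos t ht)).intervalIntegrable, add_zero]
  ring

/-- Bernoulli polynomials of even index attain their extreme value on `[0, 1]` at `0`. -/
theorem neg_one_pow_mul_bernoulliFun_le {k : ℕ} (hk : k ≠ 0) {t : ℝ} (ht : t ∈ Set.Icc (0 : ℝ) 1) :
    (-1) ^ (k + 1) * bernoulliFun (2 * k) t ≤ (-1) ^ (k + 1) * (bernoulli (2 * k) : ℝ) := by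
  have h := hasSum_le (fun n => ?_) (hasSum_one_div_nat_pow_mul_cos hk ht)
    (hasSum_one_div_nat_pow_mul_cos hk (Set.left_mem_Icc.mpr zero_le_one))
  · change _ * bernoulliFun (2 * k) t ≤ _ * bernoulliFun (2 * k) 0 at h
    rw [bernoulliFun_eval_zero] at h
    have hc : 0 < (2 * Real.pi) ^ (2 * k) / 2 / ((2 * k).factorial : ℝ) := by positivity
    refine le_of_mul_le_mul_left ?_ hc
    simpa only [mul_div_assoc, mul_assoc, mul_left_comm] using h
  · rw [mul_zero, Real.cos_zero]
    exact mul_le_mul_of_nonneg_left (Real.cos_le_one _) (by positivity)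

/-- The error in Stirling's series for `log Γ` truncated after `N` terms. -/
noncomputable def stirlingRemainder (N : ℕ) (x : ℝ) : ℝ :=
  Real.log (Real.Gamma x) - (x - 1 / 2) * Real.log x + x - (1 / 2) * Real.log (2 * Real.pi)
    - ∑ m ∈ Finset.Icc 1 N,
        (bernoulli (2 * m) : ℝ) / ((2 * (m : ℝ)) * (2 * (m : ℝ) - 1) * x ^ (2 * m - 1))

theorem stirlingRemainder_succ (N : ℕ) (x : ℝ) :
    stirlingRemainder (N + 1) x = stirlingRemainder N x -
      (bernoulli (2 * N + 2) : ℝ) / ((2 * (N : ℝ) + 1) * (2 * (N : ℝ) + 2) * x ^ (2 * N + 1)) := by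
  rw [stirlingRemainder, Finset.sum_Icc_succ_top (by lia), stirlingRemainder,
    show 2 * (N + 1) - 1 = 2 * N + 1 by lia, show 2 * (N + 1) = 2 * N + 2 by lia]
  push_cast
  ring

theorem log_Gamma_add_one {y : ℝ} (hy : 0 < y) :
    Real.log (Real.Gamma (y + 1)) = Real.log (Real.Gamma y) + Real.log y := by
  rw [Real.Gamma_add_one hy.ne', Real.log_mul hy.ne' (Real.Gamma_pos_of_pos hy).ne', add_comm]

theorem stirlingRemainder_sub_add_one (N : ℕ) {y : ℝ} (hy : 0 < y) :
    stirlingRemainder N y - stirlingRemainder N (y + 1) =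
      -(∫ t in (0 : ℝ)..1, bernoulliFun (2 * N + 1) t / (y + t) ^ (2 * N + 1)) / (2 * N + 1) := by
  induction N with
  | zero =>
    simp only [mul_zero, zero_add, integral_bernoulliFun_one_div hy]
    simp only [stirlingRemainder, log_Gamma_add_one hy]
    simp
    ring
  | succ N ih =>
    have h₁ := integral_bernoulliFun_div_pow (k := 2 * N + 1) (by lia) hy 0
    have h₂ := integral_bernoulliFun_div_pow (k := 2 * N + 2) (by lia) hy 0
    rw [bernoulli_eq_zero_of_odd ⟨N + 1, by ring⟩ (by lia)] at h₂
    simp only [sub_zero] at h₁ h₂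
    rw [h₁, h₂] at ih
    rw [stirlingRemainder_succ, stirlingRemainder_succ, sub_sub_sub_comm, ih,
      show 2 * (N + 1) + 1 = 2 * N + 2 + 1 by ring, show 2 * N + 1 + 1 = 2 * N + 2 by ring]
    have := hy.ne'
    have : y + 1 ≠ 0 := by positivity
    push_cast
    field_simp
    ring

theorem tendsto_stirlingRemainder_zero {x : ℝ} (hx : 0 < x) :
    Tendsto (fun n : ℕ => stirlingRemainder 0 (x + (n + 1 : ℕ))) atTop (𝓝 0) := by
  have hL : Tendsto (fun n : ℕ => Real.log (1 + (x + 1) / n)) atTop (𝓝 0) := by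
    have h : Tendsto (fun n : ℕ => 1 + (x + 1) / (n : ℝ)) atTop (𝓝 (1 + 0)) :=
      (tendsto_const_div_atTop_nhds_zero_nat (x + 1)).const_add 1
    rw [add_zero] at h
    simpa using h.log one_ne_zero
  have hnL := (Real.tendsto_mul_log_one_add_div_atTop (x + 1)).comp tendsto_natCast_atTop_atTop
  have hS := Stirling.tendsto_stirlingSeq_sqrt_pi.log (by positivity)
  have hG := Real.BohrMollerup.tendsto_log_gamma hx
  have h := (((hG.const_sub (Real.log (Real.Gamma x))).add
    (hS.sub_const (Real.log √Real.pi))).add (hnL.const_sub (x + 1))).sub (hL.const_mul (x + 1 / 2))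
  simp only [sub_self, mul_zero, add_zero] at h
  refine h.congr' ?_
  filter_upwards [eventually_gt_atTop 0] with n hn
  have hn' : (0 : ℝ) < n := by exact_mod_cast hn
  have hΓ := Real.BohrMollerup.f_add_nat_eq (f := fun y => Real.log (Real.Gamma y))
    (fun {y} hy => log_Gamma_add_one hy) hx (n + 1)
  have hlog : Real.log (x + (n + 1 : ℕ)) = Real.log n + Real.log (1 + (x + 1) / n) := by
    rw [← Real.log_mul hn'.ne' (by positivity)]
    congr 1
    push_cast
    field_simp
    ring
  simp only [Function.comp_apply, Stirling.log_stirlingSeq_formula,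
    Real.BohrMollerup.logGammaSeq, stirlingRemainder, hΓ, hlog]
  rw [Real.log_sqrt Real.pi_pos.le, Real.log_mul two_ne_zero Real.pi_ne_zero,
    Real.log_mul two_ne_zero hn'.ne', Real.log_div hn'.ne' (Real.exp_ne_zero 1), Real.log_exp]
  simp
  ring

theorem tendsto_stirlingRemainder (N : ℕ) {x : ℝ} (hx : 0 < x) :
    Tendsto (fun n : ℕ => stirlingRemainder N (x + (n + 1 : ℕ))) atTop (𝓝 0) := by
  induction N with
  | zero => exact tendsto_stirlingRemainder_zero hx
  | succ N ih =>
    have hy : Tendsto (fun n : ℕ => x + (n + 1 : ℕ)) atTop atTop :=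
      tendsto_atTop_add_const_left _ _
        (tendsto_natCast_atTop_atTop.comp (tendsto_add_atTop_nat 1))
    have hp : Tendsto (fun n : ℕ => (2 * (N : ℝ) + 1) * (2 * (N : ℝ) + 2) *
        (x + (n + 1 : ℕ)) ^ (2 * N + 1)) atTop atTop :=
      ((tendsto_pow_atTop (by lia)).comp hy).const_mul_atTop (by positivity)
    simpa only [stirlingRemainder_succ, sub_zero] using
      ih.sub (hp.const_div_atTop (bernoulli (2 * N + 2) : ℝ))

theorem neg_one_pow_mul_stirlingRemainder_add_one_le (N : ℕ) {y : ℝ} (hy : 0 < y) :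
    (-1) ^ N * stirlingRemainder N (y + 1) ≤ (-1) ^ N * stirlingRemainder N y := by
  rw [← sub_nonneg, ← mul_sub, stirlingRemainder_sub_add_one N hy,
    integral_bernoulliFun_div_pow (by lia) hy (bernoulli (2 * N + 1 + 1)), sub_self, zero_div,
    zero_mul, zero_add]
  have h : 0 ≤ ∫ t in (0 : ℝ)..1, (-1) ^ (N + 1) *
      ((bernoulliFun (2 * N + 1 + 1) t - bernoulli (2 * N + 1 + 1)) / (y + t) ^ (2 * N + 1 + 1)) := by
    refine intervalIntegral.integral_nonneg zero_le_one fun t ht => ?_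
    rw [← mul_div_assoc]
    refine div_nonneg ?_ (pow_nonneg (by linarith [ht.1]) _)
    have := neg_one_pow_mul_bernoulliFun_le N.succ_ne_zero ht
    rw [Nat.succ_eq_add_one, show 2 * (N + 1) = 2 * N + 1 + 1 by ring, pow_succ _ (N + 1)] at this
    linarith
  rw [intervalIntegral.integral_const_mul] at h
  refine (mul_nonneg (by positivity : (0 : ℝ) ≤ 1 / (2 * N + 1 + 1)) h).trans_eq ?_
  push_cast
  field_simp
  ring

/-- The truncation error of Stirling's series has the sign of the first omitted term. -/
theorem neg_one_pow_mul_stirlingRemainder_nonneg (N : ℕ) {x : ℝ} (hx : 0 < x) :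
    0 ≤ (-1) ^ N * stirlingRemainder N x := by
  have hanti : Antitone fun n : ℕ => (-1) ^ N * stirlingRemainder N (x + n) :=
    antitone_nat_of_succ_le fun n => by
      rw [Nat.cast_succ, ← add_assoc]
      exact neg_one_pow_mul_stirlingRemainder_add_one_le N (by positivity)
  have hlim : Tendsto (fun n : ℕ => (-1) ^ N * stirlingRemainder N (x + n)) atTop (𝓝 0) := by
    rw [← tendsto_add_atTop_iff_nat 1]
    simpa using (tendsto_stirlingRemainder N hx).const_mul ((-1) ^ N)
  simpa using hanti.le_of_tendsto hlim 0

/-- Stirling series with remainder bound: for every real `x > 0` and integer `N ≥ 1`,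
`|log Γ(x) - (x - 1/2) log x + x - (1/2) log (2π)
   - ∑_{m=1}^N B_{2m}/(2m(2m-1) x^(2m-1))| ≤ |B_{2N+2}|/((2N+1)(2N+2) x^(2N+1))`. -/
theorem stirling_series_remainder_bound (x : ℝ) (hx : 0 < x) (N : ℕ) (hN : 1 ≤ N) :
    |Real.log (Real.Gamma x) - (x - 1 / 2) * Real.log x + x - (1 / 2) * Real.log (2 * Real.pi)
        - ∑ m ∈ Finset.Icc 1 N,
            (bernoulli (2 * m) : ℝ) / ((2 * (m : ℝ)) * (2 * (m : ℝ) - 1) * x ^ (2 * m - 1))|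
      ≤ |(bernoulli (2 * N + 2) : ℝ)|
          / ((2 * (N : ℝ) + 1) * (2 * (N : ℝ) + 2) * x ^ (2 * N + 1)) := by
  change |stirlingRemainder N x| ≤ _
  have h₀ := neg_one_pow_mul_stirlingRemainder_nonneg N hx
  have h₁ := neg_one_pow_mul_stirlingRemainder_nonneg (N + 1) hx
  rw [stirlingRemainder_succ, pow_succ] at h₁
  set D : ℝ := (2 * (N : ℝ) + 1) * (2 * (N : ℝ) + 2) * x ^ (2 * N + 1)
  have hDpos : 0 < D := by positivity
  have habs (a : ℝ) : |(-1) ^ N * a| = |a| := by simp [abs_mul]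
  rw [← abs_of_pos hDpos, ← abs_div, ← habs (stirlingRemainder N x), ← habs (_ / D),
    abs_of_nonneg h₀]
  exact le_trans (by linarith) (le_abs_self _)
end
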